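/- arXiv:2509.11494 — 3 statements merged into one kernel-verified Lean document; each statement's English description precedes it below -/
import Mathlib

section
/- For all integers n ≥ 1 and k ≥ 1, the number of Jacobi permutations π of [n] whose last letter π_n equals k is equal to the number of up-down alternating permutations τ of [n] whose first letter τ_1 equals k (the Entringer number E_{n,k}). -/
/-- The length of `ρ_π(π_k)`: the maximal consecutive subword of `π` immediately to the
right of position `k`, all of whose letters are larger than `π_k`.  Letters of a
permutation of `[n] = {1,…,n}` are modelled by `(π i : ℕ) + 1` for `π : Equiv.Perm (Fin n)`. -/
noncomputable def rhoLen {n : ℕ} (π : Equiv.Perm (Fin n)) (k : Fin n) : ℕ :=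
  Nat.card {j : Fin n // k < j ∧ ∀ i : Fin n, k < i → i ≤ j → π k < π i}

/-- A permutation is Jacobi if `ρ_π(π_k)` has even length for every position `k`. -/
def IsJacobi {n : ℕ} (π : Equiv.Perm (Fin n)) : Prop :=
  ∀ k : Fin n, Even (rhoLen π k)

/-- The last letter of `π`, as an element of `[n] = {1,…,n}` (junk value `0` if `n = 0`). -/
def lastVal {n : ℕ} (π : Equiv.Perm (Fin n)) : ℕ :=
  if h : 0 < n then (π ⟨n - 1, Nat.sub_lt h Nat.one_pos⟩ : ℕ) + 1 else 0

/-- The first letter of `π`, as an element of `[n] = {1,…,n}` (junk value `0` if `n = 0`). -/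
def firstVal {n : ℕ} (π : Equiv.Perm (Fin n)) : ℕ :=
  if h : 0 < n then (π ⟨0, h⟩ : ℕ) + 1 else 0

/-- `π` is up-down alternating: `π₁ < π₂ > π₃ < π₄ > ⋯`. -/
def IsUpDown {n : ℕ} (π : Equiv.Perm (Fin n)) : Prop :=
  ∀ (k : ℕ) (h : k + 1 < n),
    if k % 2 = 0 then π ⟨k, by omega⟩ < π ⟨k + 1, h⟩
    else π ⟨k + 1, h⟩ < π ⟨k, by omega⟩

def JacL : List ℕ → Prop
  | [] => True
  | x :: l => Even (l.takeWhile (fun y => decide (x < y))).length ∧ JacL l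

def AltL : Bool → List ℕ → Prop
  | _, [] => True
  | _, [_] => True
  | b, x :: y :: l => (if b = true then x < y else y < x) ∧ AltL (!b) (y :: l)

theorem jacL_split (a : ℕ) (A B : List ℕ) (hA : ∀ x ∈ A, a < x) (hB : ∀ x ∈ B, a < x) :
    JacL (A ++ a :: B) ↔ JacL A ∧ Even B.length ∧ JacL B := by
  induction A with
  | nil =>
    have : B.takeWhile (fun y => decide (a < y)) = B := by
      rw [List.takeWhile_eq_self_iff]; simpa using hB
    simp [JacL, this]
  | cons x A ih =>
    have hx : ¬ x < a := by have := hA x (by simp); omega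
    have h2 : (A ++ a :: B).takeWhile (fun y => decide (x < y)) =
        A.takeWhile (fun y => decide (x < y)) := by
      rw [List.takeWhile_append]
      split_ifs with h
      · simp only [List.takeWhile_cons, decide_eq_true_eq, if_neg hx, List.append_nil]
        have := (List.takeWhile_prefix (l := A) (fun y => decide (x < y))).eq_of_length h
        exact this.symm
      · rfl
    simp only [List.cons_append, JacL, h2, ih (fun x hx => hA x (by simp [hx]))]
    tauto

theorem altL_cons_min (a : ℕ) (D : List ℕ) (hD : ∀ x ∈ D, a < x) :
    AltL true (a :: D) ↔ AltL false D := by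
  cases D with
  | nil => simp [AltL]
  | cons d D => simp [AltL, hD d]

theorem altL_split_aux (a : ℕ) (C D : List ℕ) (hC : ∀ x ∈ C, a < x) (hD : ∀ x ∈ D, a < x)
    (hne : C ≠ []) (b : Bool) :
    AltL b (C ++ a :: D) ↔ (b = true ↔ Even C.length) ∧ AltL b C ∧ AltL false D := by
  induction C generalizing b with
  | nil => exact absurd rfl hne
  | cons c C ih =>
    cases C with
    | nil =>
      have h := hC c (by simp)
      have h' : ¬ c < a := by omega
      cases b
      · simp [AltL, h, altL_cons_min a D hD]
      · simp [AltL, h']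
    | cons c' C =>
      have := ih (fun x hx => hC x (by simp [hx])) (by simp) (!b)
      simp only [List.cons_append] at this ⊢
      simp only [AltL, this]
      simp only [List.length_cons]
      cases b <;> simp [Nat.even_add_one] <;> tauto

theorem altL_split (a : ℕ) (C D : List ℕ) (hC : ∀ x ∈ C, a < x) (hD : ∀ x ∈ D, a < x) :
    AltL true (C ++ a :: D) ↔ Even C.length ∧ AltL true C ∧ AltL false D := by
  by_cases h : C = []
  · subst h; simp [AltL, altL_cons_min a D hD]
  · simp [altL_split_aux a C D hC hD h]

def wordsOn (S : Finset ℕ) : Finset (List ℕ) := S.val.lists.toFinset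

theorem mem_wordsOn (S : Finset ℕ) (w : List ℕ) :
    w ∈ wordsOn S ↔ w.Nodup ∧ ∀ x, x ∈ w ↔ x ∈ S := by
  unfold wordsOn
  rw [Multiset.mem_toFinset, Multiset.mem_lists_iff]
  constructor
  · intro h
    constructor
    · have := S.nodup; rw [h] at this; simpa using this
    · intro x; rw [← Finset.mem_val, h]; simp
  · rintro ⟨h1, h2⟩
    have : S.val = (w : Multiset ℕ) := by
      rw [Multiset.Nodup.ext S.nodup (by simpa using h1)]
      intro x; simp [h2]
    exact this

theorem length_wordsOn {S : Finset ℕ} {w : List ℕ} (h : w ∈ wordsOn S) : w.length = S.card := by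
  unfold wordsOn at h
  rw [Multiset.mem_toFinset, Multiset.mem_lists_iff] at h
  rw [Finset.card_def, h]; simp

theorem append_min_inj (a : ℕ) : ∀ (A B A' B' : List ℕ), a ∉ A → a ∉ A' →
    A ++ a :: B = A' ++ a :: B' → A = A' ∧ B = B' := by
  intro A
  induction A with
  | nil => intro B A' B' h h' e; cases A' <;> simp_all
  | cons x A ih =>
    intro B A' B' h h' e
    cases A' with
    | nil => simp_all
    | cons y A' =>
      simp only [List.cons_append, List.cons.injEq] at e
      have := ih B A' B' (by simp_all) (by simp_all) e.2
      simp_all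

theorem card_split (S : Finset ℕ) (a : ℕ) (ha : a ∈ S) (R P Q : List ℕ → Prop)
    [DecidablePred R] [DecidablePred P] [DecidablePred Q]
    (h : ∀ A B, A ++ a :: B ∈ wordsOn S → (R (A ++ a :: B) ↔ P A ∧ Q B)) :
    ((wordsOn S).filter R).card =
      ∑ T ∈ (S.erase a).powerset,
        ((wordsOn (S.erase a \ T)).filter P).card * ((wordsOn T).filter Q).card := by
  simp_rw [← Finset.card_product]
  rw [← Finset.card_sigma]
  symm
  have key : ∀ T ⊆ S.erase a, ∀ A ∈ wordsOn (S.erase a \ T), ∀ B ∈ wordsOn T,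
      A ++ a :: B ∈ wordsOn S := by
    intro T hT A hA B hB
    rw [mem_wordsOn] at *
    obtain ⟨hA1, hA2⟩ := hA
    obtain ⟨hB1, hB2⟩ := hB
    have hT' : ∀ x ∈ T, x ≠ a ∧ x ∈ S := fun x hx => by simpa using hT hx
    simp only [Finset.mem_sdiff, Finset.mem_erase] at hA2
    constructor
    · rw [List.nodup_append]
      refine ⟨hA1, ?_, ?_⟩
      · rw [List.nodup_cons]; grind
      · grind
    · intro x; simp only [List.mem_append, List.mem_cons]; grind
  refine Finset.card_bij (fun p _ => p.2.1 ++ a :: p.2.2) ?_ ?_ ?_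
  · rintro ⟨T, A, B⟩ hp
    simp only [Finset.mem_sigma, Finset.mem_powerset, Finset.mem_product, Finset.mem_filter] at hp ⊢
    have := key T hp.1 A hp.2.1.1 B hp.2.2.1
    exact ⟨this, (h A B this).2 ⟨hp.2.1.2, hp.2.2.2⟩⟩
  · rintro ⟨T, A, B⟩ hp ⟨T', A', B'⟩ hp' e
    simp only [Finset.mem_sigma, Finset.mem_powerset, Finset.mem_product, Finset.mem_filter,
      mem_wordsOn] at hp hp'
    obtain ⟨e1, e2⟩ := append_min_inj a A B A' B' (by rw [hp.2.1.1.2]; simp)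
      (by rw [hp'.2.1.1.2]; simp) e
    subst e1 e2
    have : T = T' := by
      ext x; rw [← hp.2.2.1.2, ← hp'.2.2.1.2]
    subst this
    rfl
  · intro w hw
    rw [Finset.mem_filter] at hw
    obtain ⟨hw1, hw2⟩ := hw
    have haw : a ∈ w := ((mem_wordsOn _ _).1 hw1).2 a |>.2 ha
    obtain ⟨A, B, rfl⟩ := List.append_of_mem haw
    have hPQ := (h A B hw1).1 hw2
    rw [mem_wordsOn] at hw1
    obtain ⟨hn, hm⟩ := hw1
    rw [List.nodup_append, List.nodup_cons] at hn
    simp only [List.mem_append, List.mem_cons] at hm hn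
    refine ⟨⟨B.toFinset, A, B⟩, ?_, rfl⟩
    simp only [Finset.mem_sigma, Finset.mem_powerset, Finset.mem_product, Finset.mem_filter,
      mem_wordsOn]
    refine ⟨?_, ⟨⟨hn.1, ?_⟩, hPQ.1⟩, ⟨hn.2.1.2, by simp⟩, hPQ.2⟩
    · intro x hx
      rw [List.mem_toFinset] at hx
      rw [Finset.mem_erase]; grind
    · intro x
      simp only [Finset.mem_sdiff, Finset.mem_erase, List.mem_toFinset]; grind

theorem exists_anti (S : Finset ℕ) : ∃ f : ℕ → ℕ, (∀ x ∈ S, f x ∈ S) ∧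
    ∀ x ∈ S, ∀ y ∈ S, (f x < f y ↔ y < x) := by
  classical
  refine ⟨fun x => if h : x ∈ S then
    S.orderIsoOfFin rfl (Fin.rev ((S.orderIsoOfFin rfl).symm ⟨x, h⟩)) else x, ?_, ?_⟩
  · intro x hx; simp only [hx, dif_pos]; exact Subtype.property _
  · intro x hx y hy
    simp only [hx, hy, dif_pos]
    rw [Subtype.coe_lt_coe, OrderIso.lt_iff_lt, Fin.rev_lt_rev, OrderIso.lt_iff_lt, Subtype.mk_lt_mk]

theorem altL_map (S : Finset ℕ) (f : ℕ → ℕ)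
    (hf : ∀ x ∈ S, ∀ y ∈ S, (f x < f y ↔ y < x)) :
    ∀ (w : List ℕ) (b : Bool), (∀ x ∈ w, x ∈ S) → AltL b w → AltL (!b) (w.map f)
  | [], _, _, _ => by simp [AltL]
  | [_], _, _, _ => by simp [AltL]
  | x :: y :: l, b, hS, h => by
    have h1 := hf x (hS x (by simp)) y (hS y (by simp))
    have h2 := hf y (hS y (by simp)) x (hS x (by simp))
    have ih := altL_map S f hf (y :: l) (!b) (fun z hz => hS z (by simp [hz])) h.2
    have h0 := h.1
    refine ⟨?_, ih⟩
    cases b <;> simp_all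

open Classical in
theorem card_alt_le (S : Finset ℕ) (b : Bool) :
    ((wordsOn S).filter (AltL b)).card ≤ ((wordsOn S).filter (AltL (!b))).card := by
  obtain ⟨f, hfS, hf⟩ := exists_anti S
  have hinj : ∀ x ∈ S, ∀ y ∈ S, f x = f y → x = y := by
    intro x hx y hy e
    have h1 := hf x hx y hy
    have h2 := hf y hy x hx
    omega
  refine Finset.card_le_card_of_injOn (List.map f) ?_ ?_
  · intro w hw
    simp only [Finset.coe_filter, Set.mem_ofPred_eq, mem_wordsOn] at hw ⊢
    obtain ⟨⟨hn, hm⟩, hw⟩ := hw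
    refine ⟨⟨?_, ?_⟩, altL_map S f hf w b (fun x hx => (hm x).1 hx) hw⟩
    · exact List.Nodup.map_on (fun x hx y hy => hinj x ((hm x).1 hx) y ((hm y).1 hy)) hn
    · intro x
      have himg : S.image f = S := by
        apply Finset.eq_of_subset_of_card_le
        · intro y hy
          obtain ⟨z, hz, rfl⟩ := Finset.mem_image.1 hy
          exact hfS z hz
        · rw [Finset.card_image_of_injOn]
          intro x hx y hy; exact hinj x hx y hy
      conv_rhs => rw [← himg]
      simp [hm]
  · intro w hw w' hw' e
    simp only [Finset.coe_filter, Set.mem_ofPred_eq, mem_wordsOn] at hw hw'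
    have hw1 := hw.1.2
    have hw2 := hw'.1.2
    have gen : ∀ (w w' : List ℕ), (∀ x ∈ w, x ∈ S) → (∀ x ∈ w', x ∈ S) →
        w.map f = w'.map f → w = w' := by
      intro w
      induction w with
      | nil => intro w' _ _ e; cases w' <;> simp_all
      | cons x w ih =>
        intro w' h1 h2 e
        cases w' with
        | nil => simp at e
        | cons y w' =>
          simp only [List.map_cons, List.cons.injEq] at e
          rw [hinj x (h1 x (by simp)) y (h2 y (by simp)) e.1,
            ih w' (fun z hz => h1 z (by simp [hz])) (fun z hz => h2 z (by simp [hz])) e.2]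
    exact gen w w' (fun x => (hw1 x).1) (fun x => (hw2 x).1) e

open Classical in
theorem card_alt_eq (S : Finset ℕ) :
    ((wordsOn S).filter (AltL true)).card = ((wordsOn S).filter (AltL false)).card :=
  le_antisymm (card_alt_le S true) (card_alt_le S false)

theorem card_even (T : Finset ℕ) (P : List ℕ → Prop) [DecidablePred P] :
    ((wordsOn T).filter (fun w => Even w.length ∧ P w)).card =
      if Even T.card then ((wordsOn T).filter P).card else 0 := by
  split_ifs with h
  · congr 1
    apply Finset.filter_congr
    intro w hw
    rw [length_wordsOn hw]; simp [h]
  · rw [Finset.card_eq_zero, Finset.filter_eq_empty_iff]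
    intro w hw
    rw [length_wordsOn hw]; simp [h]

open Classical in
theorem main_count (N : ℕ) : ∀ (S : Finset ℕ), S.card = N → ∀ (p : ℕ → Prop) (d : ℕ),
    ((wordsOn S).filter (fun w => JacL w ∧ p (w.getLastD d))).card =
      ((wordsOn S).filter (fun w => AltL true w ∧ p (w.headD d))).card := by
  induction N using Nat.strong_induction_on with
  | _ N ih =>
    intro S hS p d
    rcases S.eq_empty_or_nonempty with rfl | hne
    · congr 1
      apply Finset.filter_congr
      intro w hw
      have : w = [] := by
        have := length_wordsOn hw
        simpa using this
      subst this
      simp [JacL, AltL]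
    · set a := S.min' hne with ha_def
      have ha : a ∈ S := S.min'_mem hne
      have hmin : ∀ A B : List ℕ, A ++ a :: B ∈ wordsOn S →
          (∀ x ∈ A, a < x) ∧ (∀ x ∈ B, a < x) := by
        intro A B h
        rw [mem_wordsOn, List.nodup_append, List.nodup_cons] at h
        obtain ⟨hn, hm⟩ := h
        simp only [List.mem_append, List.mem_cons] at hm hn
        have hle : ∀ x ∈ S, a ≤ x := fun x hx => S.min'_le x hx
        constructor
        · intro x hx
          have h1 := hle x ((hm x).1 (Or.inl hx))
          have h2 := hn.2.2 x hx a (Or.inl rfl)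
          omega
        · intro x hx
          have h1 := hle x ((hm x).1 (Or.inr (Or.inr hx)))
          have h2 : x ≠ a := fun e => hn.2.1.1 (e ▸ hx)
          omega
      rw [card_split S a ha _ JacL (fun B => Even B.length ∧ (JacL B ∧ p (B.getLastD a))),
        card_split S a ha _ (fun C => Even C.length ∧ (AltL true C ∧ p (C.headD a)))
          (AltL false)]
      · refine Finset.sum_nbij' (fun T => S.erase a \ T) (fun T => S.erase a \ T)
          ?_ ?_ ?_ ?_ ?_
        · intro T hT; simp
        · intro T hT; simp
        · intro T hT; exact Finset.sdiff_sdiff_eq_self (Finset.mem_powerset.1 hT)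
        · intro T hT; exact Finset.sdiff_sdiff_eq_self (Finset.mem_powerset.1 hT)
        · intro T hT
          rw [Finset.mem_powerset] at hT
          have hlt : (S.erase a).card < N := by
            rw [← hS]; exact Finset.card_erase_lt_of_mem ha
          have hTc : T.card < N := lt_of_le_of_lt (Finset.card_le_card hT) hlt
          have hTc' : (S.erase a \ T).card < N :=
            lt_of_le_of_lt (Finset.card_le_card Finset.sdiff_subset) hlt
          rw [Finset.sdiff_sdiff_eq_self hT, card_even, card_even, ih _ hTc T rfl p a,
            ← card_alt_eq, mul_comm]
          congr 1
          have := ih _ hTc' _ rfl (fun _ => True) 0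
          simpa using this
      · intro A B h
        obtain ⟨h1, h2⟩ := hmin A B h
        have : (A ++ a :: B).headD d = A.headD a := by cases A <;> simp
        rw [altL_split a A B h1 h2, this]; tauto
      · intro A B h
        obtain ⟨h1, h2⟩ := hmin A B h
        have : (A ++ a :: B).getLastD d = B.getLastD a := by
          simp [List.getLastD_eq_getLast?, List.getLast?_cons]
        rw [jacL_split a A B h1 h2, this]; tauto

def permWord {n : ℕ} (π : Equiv.Perm (Fin n)) : List ℕ := List.ofFn (fun i => (π i : ℕ))

theorem permWord_length {n : ℕ} (π : Equiv.Perm (Fin n)) : (permWord π).length = n := by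
  simp [permWord]

theorem permWord_getElem {n : ℕ} (π : Equiv.Perm (Fin n)) (i : ℕ) (h : i < (permWord π).length) :
    (permWord π)[i] = (π ⟨i, by simpa [permWord] using h⟩ : ℕ) := by
  simp [permWord]

theorem card_transport (n : ℕ) (P : Equiv.Perm (Fin n) → Prop) (P' : List ℕ → Prop)
    [DecidablePred P'] (h : ∀ π, P π ↔ P' (permWord π)) :
    Nat.card {π : Equiv.Perm (Fin n) // P π} =
      ((wordsOn (Finset.range n)).filter P').card := by
  classical
  rw [Nat.card_eq_fintype_card, Fintype.card_subtype]
  refine Finset.card_bij (fun π _ => permWord π) ?_ ?_ ?_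
  · intro π hπ
    simp only [Finset.mem_filter, Finset.mem_univ, true_and] at hπ
    rw [Finset.mem_filter, mem_wordsOn]
    refine ⟨⟨?_, ?_⟩, (h π).1 hπ⟩
    · unfold permWord
      rw [List.nodup_ofFn]
      intro i j e
      exact π.injective (Fin.ext e)
    · intro x
      simp only [permWord, List.mem_ofFn, Finset.mem_range]
      constructor
      · rintro ⟨i, rfl⟩; exact (π i).2
      · intro hx; exact ⟨π.symm ⟨x, hx⟩, by simp⟩
  · intro π _ π' _ e
    have := List.ofFn_injective e
    ext i
    exact congrFun this i
  · intro w hw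
    rw [Finset.mem_filter] at hw
    obtain ⟨hw, hP⟩ := hw
    have hl := length_wordsOn hw
    rw [Finset.card_range] at hl
    rw [mem_wordsOn] at hw
    obtain ⟨hn, hm⟩ := hw
    let f : Fin n → Fin n := fun i => ⟨w[(i : ℕ)]'(by omega), by
      have := (hm (w[(i : ℕ)]'(by omega))).1 (List.getElem_mem _)
      simpa using this⟩
    have hf : Function.Injective f := by
      intro i j e
      have e' : w[(i : ℕ)]'(by omega) = w[(j : ℕ)]'(by omega) := congrArg Fin.val e
      exact Fin.ext ((List.Nodup.getElem_inj_iff hn).1 e')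
    let π : Equiv.Perm (Fin n) := Equiv.ofBijective f (Finite.injective_iff_bijective.1 hf)
    have hπ : permWord π = w := by
      apply List.ext_getElem
      · rw [permWord_length, hl]
      · intro i h1 h2
        rw [permWord_getElem]
        rfl
    refine ⟨π, ?_, hπ⟩
    simp only [Finset.mem_filter, Finset.mem_univ, true_and]
    rw [h, hπ]; exact hP

theorem jacL_iff (w : List ℕ) : JacL w ↔ ∀ (k : ℕ) (h : k < w.length),
    Even ((w.drop (k + 1)).takeWhile (fun y => decide (w[k] < y))).length := by
  induction w with
  | nil => simp [JacL]
  | cons x w ih =>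
    rw [JacL, ih]
    constructor
    · rintro ⟨h1, h2⟩ k hk
      cases k with
      | zero => simpa using h1
      | succ k => simpa using h2 k (by simpa using hk)
    · intro h
      refine ⟨h 0 (by simp), fun k hk => ?_⟩
      exact h (k + 1) (by simpa using hk)

theorem lt_takeWhile_iff (q : ℕ → Bool) (l : List ℕ) (t : ℕ) :
    t < (l.takeWhile q).length ↔ ∀ s ≤ t, ∃ h : s < l.length, q l[s] = true := by
  induction l generalizing t with
  | nil => simp; exact ⟨t, le_rfl⟩
  | cons x l ih =>
    by_cases hx : q x = true
    · rw [List.takeWhile_cons_of_pos hx]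
      cases t with
      | zero => simp [hx]
      | succ t =>
        simp only [List.length_cons, Nat.add_lt_add_iff_right, ih]
        constructor
        · intro h s hs
          cases s with
          | zero => simp [hx]
          | succ s => simpa using h s (by omega)
        · intro h s hs
          simpa using h (s + 1) (by omega)
    · rw [List.takeWhile_cons_of_neg hx]
      simp only [List.length_nil, Nat.not_lt_zero, false_iff]
      intro h
      obtain ⟨_, h⟩ := h 0 (by omega)
      exact hx (by simpa using h)

theorem rhoLen_eq {n : ℕ} (π : Equiv.Perm (Fin n)) (k : ℕ) (hk : k < n) :
    rhoLen π ⟨k, hk⟩ = (((permWord π).drop (k + 1)).takeWhile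
      (fun y => decide ((permWord π)[k]'(by rw [permWord_length]; exact hk) < y))).length := by
  classical
  set m := (((permWord π).drop (k + 1)).takeWhile
      (fun y => decide ((permWord π)[k]'(by rw [permWord_length]; exact hk) < y))).length with hm
  have hmt : ∀ t, t < m ↔ ∀ s ≤ t, ∃ h : k + 1 + s < n, π ⟨k, hk⟩ < π ⟨k + 1 + s, h⟩ := by
    intro t
    rw [hm, lt_takeWhile_iff]
    refine forall_congr' fun s => forall_congr' fun hs => ?_
    simp only [List.length_drop, permWord_length, List.getElem_drop, permWord_getElem,
      decide_eq_true_eq, Fin.lt_def]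
    constructor
    · rintro ⟨h1, h2⟩; exact ⟨by omega, h2⟩
    · rintro ⟨h1, h2⟩; exact ⟨by omega, h2⟩
  unfold rhoLen
  rw [Nat.card_eq_fintype_card, Fintype.card_subtype, ← Finset.card_range m]
  refine Finset.card_bij (fun j _ => (j : ℕ) - k - 1) ?_ ?_ ?_
  · intro j hj
    simp only [Finset.mem_filter, Finset.mem_univ, true_and, Fin.lt_def] at hj
    rw [Finset.mem_range, hmt]
    intro s hs
    have hj1 : k < (j : ℕ) := hj.1
    have hlt : k + 1 + s < n := by omega
    exact ⟨hlt, hj.2 ⟨k + 1 + s, hlt⟩ (by simp; omega) (by rw [Fin.le_def]; simp; omega)⟩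
  · intro i hi j hj e
    simp only [Finset.mem_filter, Finset.mem_univ, true_and, Fin.lt_def] at hi hj
    have h1 := hi.1
    have h2 := hj.1
    apply Fin.ext
    omega
  · intro t ht
    rw [Finset.mem_range, hmt] at ht
    obtain ⟨hlt, _⟩ := ht t le_rfl
    refine ⟨⟨k + 1 + t, hlt⟩, ?_, by simp; omega⟩
    simp only [Finset.mem_filter, Finset.mem_univ, true_and]
    refine ⟨by rw [Fin.lt_def]; simp; omega, ?_⟩
    intro i h1 h2
    rw [Fin.lt_def] at h1
    rw [Fin.le_def] at h2
    simp only at h1 h2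
    obtain ⟨h3, h4⟩ := ht ((i : ℕ) - k - 1) (by omega)
    have : (⟨k + 1 + ((i : ℕ) - k - 1), h3⟩ : Fin n) = i := Fin.ext (by simp; omega)
    rwa [this] at h4

theorem isJacobi_iff {n : ℕ} (π : Equiv.Perm (Fin n)) : IsJacobi π ↔ JacL (permWord π) := by
  rw [jacL_iff]
  constructor
  · intro h k hk
    rw [permWord_length] at hk
    rw [← rhoLen_eq π k hk]; exact h _
  · rintro h ⟨k, hk⟩
    rw [rhoLen_eq π k hk]
    exact h k (by rw [permWord_length]; exact hk)

theorem altL_iff : ∀ (w : List ℕ) (b : Bool), AltL b w ↔ ∀ (k : ℕ) (h : k + 1 < w.length),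
    if (k % 2 = 0 ↔ b = true) then w[k] < w[k + 1] else w[k + 1] < w[k]
  | [], _ => by simp [AltL]
  | [_], _ => by simp [AltL]
  | x :: y :: l, b => by
    rw [AltL, altL_iff (y :: l) (!b)]
    have aux : ∀ k : ℕ, ((k + 1) % 2 = 0 ↔ b = true) ↔ (k % 2 = 0 ↔ (!b) = true) := by
      intro k; cases b <;> simp <;> omega
    constructor
    · rintro ⟨h1, h2⟩ k hk
      cases k with
      | zero => simpa using h1
      | succ k =>
        simp only [aux]
        exact h2 k (by simpa using hk)
    · intro h
      refine ⟨by simpa using h 0 (by simp), fun k hk => ?_⟩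
      have := h (k + 1) (by simpa using hk)
      simp only [aux] at this
      exact this

theorem isUpDown_iff {n : ℕ} (π : Equiv.Perm (Fin n)) :
    IsUpDown π ↔ AltL true (permWord π) := by
  rw [altL_iff]
  simp only [permWord_length, permWord_getElem, iff_true]
  rfl

theorem lastVal_eq {n : ℕ} (hn : 1 ≤ n) (π : Equiv.Perm (Fin n)) :
    lastVal π = (permWord π).getLastD 0 + 1 := by
  have h0 : 0 < n := hn
  have : (permWord π).length - 1 < (permWord π).length := by rw [permWord_length]; omega
  rw [lastVal, dif_pos h0, List.getLastD_eq_getLast?, List.getLast?_eq_getElem?,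
    List.getElem?_eq_getElem this, Option.getD_some, permWord_getElem]
  simp only [permWord_length]

theorem firstVal_eq {n : ℕ} (hn : 1 ≤ n) (π : Equiv.Perm (Fin n)) :
    firstVal π = (permWord π).headD 0 + 1 := by
  have h0 : 0 < n := hn
  have : 0 < (permWord π).length := by rw [permWord_length]; omega
  rw [firstVal, dif_pos h0, List.headD_eq_head?_getD, List.head?_eq_getElem?,
    List.getElem?_eq_getElem this, Option.getD_some, permWord_getElem]

/-- The number of Jacobi permutations of `[n]` with last letter `k` equals the number of
up-down alternating permutations of `[n]` with first letter `k` (the Entringer number). -/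
theorem jacobi_last_eq_entringer (n k : ℕ) (hn : 1 ≤ n) (hk : 1 ≤ k) :
    Nat.card {π : Equiv.Perm (Fin n) // IsJacobi π ∧ lastVal π = k} =
      Nat.card {π : Equiv.Perm (Fin n) // IsUpDown π ∧ firstVal π = k} := by
  classical
  rw [card_transport n _ (fun w => JacL w ∧ w.getLastD 0 + 1 = k)
      (fun π => by rw [isJacobi_iff, lastVal_eq hn]),
    card_transport n _ (fun w => AltL true w ∧ w.headD 0 + 1 = k)
      (fun π => by rw [isUpDown_iff, firstVal_eq hn])]
  convert main_count _ (Finset.range n) rfl (fun x => x + 1 = k) 0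
end

section
/- For all n ≥ 0: the number of Jacobi permutations of [2n] avoiding 231 equals (1/(2n+1))·C(3n, n), and the number of Jacobi permutations of [2n+1] avoiding 231 equals (1/(2n+1))·C(3n+1, n+1). -/
/-- `π` avoids the pattern `123`. -/
def Avoids123 {n : ℕ} (π : Equiv.Perm (Fin n)) : Prop :=
  ¬ ∃ i j k : Fin n, i < j ∧ j < k ∧ π i < π j ∧ π j < π k

/-- `π` avoids the pattern `132`. -/
def Avoids132 {n : ℕ} (π : Equiv.Perm (Fin n)) : Prop :=
  ¬ ∃ i j k : Fin n, i < j ∧ j < k ∧ π i < π k ∧ π k < π j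

/-- `π` avoids the pattern `213`. -/
def Avoids213 {n : ℕ} (π : Equiv.Perm (Fin n)) : Prop :=
  ¬ ∃ i j k : Fin n, i < j ∧ j < k ∧ π j < π i ∧ π i < π k

/-- `π` avoids the pattern `231`. -/
def Avoids231 {n : ℕ} (π : Equiv.Perm (Fin n)) : Prop :=
  ¬ ∃ i j k : Fin n, i < j ∧ j < k ∧ π k < π i ∧ π i < π j

/-- `π` avoids the pattern `312`. -/
def Avoids312 {n : ℕ} (π : Equiv.Perm (Fin n)) : Prop :=
  ¬ ∃ i j k : Fin n, i < j ∧ j < k ∧ π j < π k ∧ π k < π i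

/-- `π` avoids the pattern `321`. -/
def Avoids321 {n : ℕ} (π : Equiv.Perm (Fin n)) : Prop :=
  ¬ ∃ i j k : Fin n, i < j ∧ j < k ∧ π k < π j ∧ π j < π i

/-- Fuss–Catalan type numbers. -/
def fcA : ℕ → ℕ → ℕ
  | 0, _ => 1
  | (_ + 1), 0 => 0
  | (n + 1), (r + 1) => fcA (n + 1) r + fcA n (r + 3)
termination_by n r => (n, r)

lemma fcA_closed (n : ℕ) : ∀ r, fcA (n + 1) r + 3 * (r + 3 * n + 2).choose n
    = (r + 3 * n + 3).choose (n + 1) := by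
  induction n with
  | zero =>
    intro r
    induction r with
    | zero => simp [fcA]
    | succ r ih => simp [fcA] at *; omega
  | succ n ih =>
    intro r
    induction r with
    | zero =>
      have h1 := Nat.add_one_mul_choose_eq (3 * n + 5) (n + 1)
      have e : 0 + 3 * (n + 1) + 2 = 3 * n + 5 := by ring
      have e2 : 0 + 3 * (n + 1) + 3 = 3 * n + 6 := by ring
      rw [e, e2]
      simp only [fcA]
      have : (n + 2) * (3 * (3 * n + 5).choose (n + 1)) = (n + 2) * (3 * n + 6).choose (n + 2) := by
        ring_nf at h1 ⊢
        omega
      have := Nat.eq_of_mul_eq_mul_left (by omega) this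
      simpa using this
    | succ r ih2 =>
      have h := ih (r + 3)
      have hA : fcA (n + 1 + 1) (r + 1) = fcA (n + 1 + 1) r + fcA (n + 1) (r + 3) := by rw [fcA]
      rw [hA]
      have e1 : r + 1 + 3 * (n + 1) + 2 = (r + 3 * n + 5) + 1 := by ring
      have e2 : r + 1 + 3 * (n + 1) + 3 = (r + 3 * n + 6) + 1 := by ring
      have e3 : r + 3 + 3 * n + 2 = r + 3 * n + 5 := by ring
      have e4 : r + 3 + 3 * n + 3 = r + 3 * n + 6 := by ring
      have e5 : r + 3 * (n + 1) + 2 = r + 3 * n + 5 := by ring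
      have e6 : r + 3 * (n + 1) + 3 = r + 3 * n + 6 := by ring
      rw [e1, e2, Nat.choose_succ_succ (r + 3 * n + 5), Nat.choose_succ_succ (r + 3 * n + 6)]
      rw [e3, e4] at h
      rw [e5, e6] at ih2
      simp only [Nat.succ_eq_add_one] at *
      omega

lemma fcA_mul (n r : ℕ) : (r + 3 * n) * fcA n r = r * (r + 3 * n).choose n := by
  cases n with
  | zero => simp [fcA]
  | succ n =>
    have h := fcA_closed n r
    have h1 := Nat.add_one_mul_choose_eq (r + 3 * n + 2) n
    have e : r + 3 * (n + 1) = r + 3 * n + 3 := by ring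
    rw [e]
    have e' : r + 3 * n + 2 + 1 = r + 3 * n + 3 := by ring
    rw [e'] at h1
    zify at *
    linear_combination (r + 3 * n + 3 : ℤ) * h - 3 * h1

lemma fcA_conv (n : ℕ) : ∀ r s, ∑ k ∈ Finset.range (n + 1), fcA k r * fcA (n - k) s
    = fcA n (r + s) := by
  induction n with
  | zero => intro r s; simp [fcA]
  | succ n ih =>
    intro r s
    induction r with
    | zero =>
      rw [Finset.sum_range_succ']
      simp [fcA]
    | succ r ih2 =>
      have e : r + 1 + s = (r + s) + 1 := by ring
      rw [e]
      conv_rhs => rw [fcA]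
      rw [← ih2, show r + s + 3 = (r + 3) + s by ring, ← ih, Finset.sum_range_succ',
        Finset.sum_range_succ' (fun k => fcA k r * fcA (n + 1 - k) s)]
      simp only [fcA, add_mul, Finset.sum_add_distrib, Nat.add_sub_add_right]
      ring

/-- Jacobi recursion sequence characterization. -/
lemma jac_rec (a : ℕ → ℕ) (h0 : a 0 = 1)
    (h : ∀ m, a (m + 1) = ∑ p ∈ Finset.range (m + 1),
      if p = 0 ∨ Odd (m - p) then a p * a (m - p) else 0) (n : ℕ) :
    a (2 * n) = fcA n 1 ∧ a (2 * n + 1) = fcA n 2 := by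
  have key : ∀ (N : ℕ) (f : ℕ → ℕ), ∑ p ∈ Finset.range (2 * N), f p
      = ∑ k ∈ Finset.range N, f (2 * k) + ∑ k ∈ Finset.range N, f (2 * k + 1) := by
    intro N f
    induction N with
    | zero => simp
    | succ N ih =>
      rw [show 2 * (N + 1) = 2 * N + 1 + 1 by ring, Finset.sum_range_succ, Finset.sum_range_succ,
        ih, Finset.sum_range_succ, Finset.sum_range_succ]
      ring
  induction n using Nat.strong_induction_on with
  | _ n ih =>
    have he : a (2 * n) = fcA n 1 := by
      cases n with
      | zero => simpa [fcA] using h0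
      | succ n =>
        rw [show 2 * (n + 1) = 2 * n + 1 + 1 by ring, h,
          show 2 * n + 1 + 1 = 2 * (n + 1) by ring, key]
        have z : ∑ k ∈ Finset.range (n + 1), (if 2 * k + 1 = 0 ∨ Odd (2 * n + 1 - (2 * k + 1)) then
            a (2 * k + 1) * a (2 * n + 1 - (2 * k + 1)) else 0) = 0 := by
          apply Finset.sum_eq_zero
          intro k hk
          rw [if_neg]
          rintro (h | h)
          · omega
          · rw [Nat.odd_iff] at h; omega
        rw [z, add_zero, show fcA (n + 1) 1 = fcA n (1 + 2) by simp [fcA], ← fcA_conv]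
        apply Finset.sum_congr rfl
        intro k hk
        rw [Finset.mem_range] at hk
        rw [if_pos (Or.inr (by rw [Nat.odd_iff]; omega)), (ih k hk).1,
          show 2 * n + 1 - 2 * k = 2 * (n - k) + 1 by omega, (ih (n - k) (by omega)).2]
    refine ⟨he, ?_⟩
    rw [h, Finset.sum_range_succ, key]
    cases n with
    | zero => simp [fcA, h0]
    | succ n =>
      have z : ∑ k ∈ Finset.range (n + 1), (if 2 * k = 0 ∨ Odd (2 * (n + 1) - (2 * k)) then
            a (2 * k) * a (2 * (n + 1) - (2 * k)) else 0) = a (2 * (n + 1)) := by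
        rw [Finset.sum_eq_single 0]
        · simp [h0]
        · intro k hk hk0
          rw [if_neg]
          rintro (h | h)
          · omega
          · rw [Nat.odd_iff] at h; omega
        · simp
      rw [z, if_neg (by simp), he, show fcA (n + 1) 2 = fcA (n + 1) 1 + fcA n (2 + 2) by
        rw [fcA], ← fcA_conv, add_zero]
      congr 1
      apply Finset.sum_congr rfl
      intro k hk
      rw [Finset.mem_range] at hk
      rw [if_pos (Or.inr (by rw [Nat.odd_iff]; omega)), (ih k hk).2,
          show 2 * (n + 1) - (2 * k + 1) = 2 * (n - k) + 1 by omega, (ih (n - k) (by omega)).2]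

/-- Function version of the permutations counted. -/
structure JGood (n : ℕ) (f : ℕ → ℕ) : Prop where
  lt : ∀ i < n, f i < n
  out : ∀ i, n ≤ i → f i = 0
  inj : ∀ i j, i < n → j < n → f i = f j → i = j
  jac : ∀ k e, k < e → e ≤ n → (∀ i, k < i → i < e → f k < f i) → (e < n → f e < f k) →
    Odd (e - k)
  av : ∀ i j k, i < j → j < k → k < n → ¬ (f k < f i ∧ f i < f j)

/-- glue two functions around a maximum -/
def jglue (l r : ℕ) (f g : ℕ → ℕ) : ℕ → ℕ := fun i =>
  if i < l then f i else if i = l then l + r else if i < l + 1 + r then l + g (i - l - 1) else 0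

lemma jglue1 {l r f g i} (h : i < l) : jglue l r f g i = f i := by simp [jglue, h]
lemma jglue2 {l r f g} : jglue l r f g l = l + r := by simp [jglue]
lemma jglue3 {l r f g i} (h : i < r) : jglue l r f g (l + 1 + i) = l + g i := by
  have h1 : ¬ (l + 1 + i < l) := by omega
  have h2 : ¬ (l + 1 + i = l) := by omega
  have h3 : l + 1 + i - l - 1 = i := by omega
  simp [jglue, h1, h2, h, h3]

lemma jglue_good {l r f g} (hf : JGood l f) (hg : JGood r g) (hlr : l = 0 ∨ Odd r) :
    JGood (l + 1 + r) (jglue l r f g) := by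
  have cas : ∀ i, i < l + 1 + r → i < l ∨ i = l ∨ ∃ t < r, i = l + 1 + t := by
    intro i hi
    rcases lt_trichotomy i l with h | h | h
    · exact Or.inl h
    · exact Or.inr (Or.inl h)
    · exact Or.inr (Or.inr ⟨i - l - 1, by omega, by omega⟩)
  refine ⟨?_, ?_, ?_, ?_, ?_⟩
  · intro i hi
    rcases cas i hi with h | rfl | ⟨t, ht, rfl⟩
    · rw [jglue1 h]; have := hf.lt i h; omega
    · rw [jglue2]; omega
    · rw [jglue3 ht]; have := hg.lt t ht; omega
  · intro i hi
    have h1 : ¬ (i < l) := by omega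
    have h2 : ¬ (i = l) := by omega
    have h3 : ¬ (i < l + 1 + r) := by omega
    simp [jglue, h1, h2, h3]
  · intro i j hi hj
    rcases cas i hi with h | rfl | ⟨t, ht, rfl⟩ <;> rcases cas j hj with h' | h' | ⟨t', ht', h'⟩
    · rw [jglue1 h, jglue1 h']; exact hf.inj i j h h'
    · subst h'; rw [jglue1 h, jglue2]; have := hf.lt i h; omega
    · subst h'; rw [jglue1 h, jglue3 ht']; have := hf.lt i h; omega
    · rw [jglue2, jglue1 h']; have := hf.lt j h'; omega
    · intro _; exact h'.symm
    · subst h'; rw [jglue2, jglue3 ht']; have := hg.lt _ ht'; omega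
    · rw [jglue3 ht, jglue1 h']; have := hf.lt j h'; omega
    · subst h'; rw [jglue2, jglue3 ht]; have := hg.lt _ ht; omega
    · subst h'; rw [jglue3 ht, jglue3 ht']; intro h; have := hg.inj t t' ht ht' (by omega); omega
  · intro k e hke he hi hend
    rcases cas k (by omega) with h | rfl | ⟨t, ht, rfl⟩
    · rw [jglue1 h] at hi hend
      have hkl := hf.lt k h
      rcases lt_or_ge e l with hel | hel
      · rw [jglue1 hel] at hend
        exact hf.jac k e hke hel.le (fun i h1 h2 => by
          have := hi i h1 h2; rwa [jglue1 (by omega)] at this) (fun _ => hend (by omega))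
      · have hE : e = l + 1 + r := by
          by_contra hne
          have hlt : e < l + 1 + r := by omega
          have h1 := hend hlt
          rcases cas e hlt with h' | h' | ⟨t', ht', h'⟩
          · omega
          · subst h'; rw [jglue2] at h1; omega
          · subst h'; rw [jglue3 ht'] at h1; omega
        have := hf.jac k l h le_rfl (fun i h1 h2 => by
          have := hi i h1 (by omega); rwa [jglue1 (by omega)] at this) (by omega)
        rcases hlr with h0 | h0
        · omega
        · rw [Nat.odd_iff] at *; omega
    · have : e = k + 1 := by
        by_contra hne
        have h1 := hi (k + 1) (by omega) (by omega)
        rw [jglue2] at h1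
        have h2 : jglue k r f g (k + 1 + 0) = _ := jglue3 (by omega)
        have := hg.lt 0 (by omega)
        simp only [add_zero] at h2
        omega
      subst this
      simp
    · obtain ⟨e', rfl⟩ : ∃ e', e = l + 1 + e' := ⟨e - l - 1, by omega⟩
      rw [jglue3 ht] at hi hend
      have := hg.jac t e' (by omega) (by omega) (fun i h1 h2 => by
        have := hi (l + 1 + i) (by omega) (by omega)
        rw [jglue3 (by omega)] at this; omega) (fun h => by
        have := hend (by omega)
        rw [jglue3 h] at this; omega)
      rwa [show l + 1 + e' - (l + 1 + t) = e' - t by omega]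
  · rintro i j k hij hjk hk ⟨h1, h2⟩
    rcases cas i (by omega) with h | rfl | ⟨t, ht, rfl⟩
    · have := hf.lt i h
      rw [jglue1 h] at h1 h2
      rcases cas k hk with h' | rfl | ⟨t', ht', rfl⟩
      · rw [jglue1 h'] at h1
        rw [jglue1 (by omega)] at h2
        exact hf.av i j k hij hjk h' ⟨h1, h2⟩
      · rw [jglue2] at h1; omega
      · rw [jglue3 ht'] at h1; omega
    · rw [jglue2] at h2
      rcases cas j (by omega) with h' | h' | ⟨t', ht', h'⟩
      · omega
      · omega
      · subst h'; rw [jglue3 ht'] at h2; have := hg.lt _ ht'; omega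
    · obtain ⟨j', rfl⟩ : ∃ e', j = l + 1 + e' := ⟨j - l - 1, by omega⟩
      obtain ⟨k', rfl⟩ : ∃ e', k = l + 1 + e' := ⟨k - l - 1, by omega⟩
      rw [jglue3 (by omega), jglue3 (by omega)] at h1 h2
      exact hg.av t j' k' (by omega) (by omega) (by omega) ⟨by omega, by omega⟩

lemma jgood_max {m f} (hf : JGood (m + 1) f) : ∃ p ≤ m, f p = m := by
  have := Finset.surj_on_of_inj_on_of_card_le (s := Finset.range (m + 1))
    (t := Finset.range (m + 1)) (fun i _ => f i)
    (fun i hi => by simpa using hf.lt i (by simpa using hi))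
    (fun i j hi hj h => hf.inj i j (by simpa using hi) (by simpa using hj) h) le_rfl m (by simp)
  obtain ⟨p, hp, h⟩ := this
  exact ⟨p, by simpa [Nat.lt_succ_iff] using hp, h.symm⟩

lemma jsplit {l r h} (H : JGood (l + 1 + r) h) (hl : h l = l + r) :
    (l = 0 ∨ Odd r) ∧ ∃ f g, JGood l f ∧ JGood r g ∧ jglue l r f g = h := by
  have A : ∀ i k, i < l → l < k → k < l + 1 + r → h i < h k := by
    intro i k hi hk hk'
    by_contra hc
    have h1 : h i ≠ h k := fun e => by have := H.inj i k (by omega) (by omega) e; omega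
    have h2 : h i ≠ h l := fun e => by have := H.inj i l (by omega) (by omega) e; omega
    have h3 := H.lt i (by omega)
    exact H.av i l k hi hk hk' ⟨by omega, by omega⟩
  have mx : ∀ i < l + 1 + r, i ≠ l → h i < l + r := by
    intro i hi hne
    have h2 : h i ≠ h l := fun e => hne (H.inj i l (by omega) (by omega) e)
    have h3 := H.lt i (by omega)
    omega
  have B : ∀ i < l, h i < l := by
    intro i hi
    have : (Finset.Ico l (l + 1 + r)).card ≤ (Finset.Ioo (h i) (l + 1 + r)).card := by
      apply Finset.card_le_card_of_injOn h
      · intro k hk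
        simp only [Finset.coe_Ico, Set.mem_Ico] at hk
        simp only [Finset.coe_Ioo, Set.mem_Ioo]
        refine ⟨?_, H.lt k hk.2⟩
        rcases eq_or_lt_of_le hk.1 with e | e
        · rw [← e, hl]; exact mx i (by omega) (by omega)
        · exact A i k hi e hk.2
      · intro a ha b hb
        simp only [Finset.coe_Ico, Set.mem_Ico] at ha hb
        exact H.inj a b ha.2 hb.2
    simp only [Nat.card_Ico, Nat.card_Ioo] at this
    omega
  have C : ∀ k, l < k → k < l + 1 + r → l ≤ h k := by
    intro k hk hk'
    have : (Finset.range l).card ≤ (Finset.range (h k)).card := by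
      apply Finset.card_le_card_of_injOn h
      · intro i hi
        simp only [Finset.coe_range, Set.mem_Iio] at hi ⊢
        exact A i k hi hk hk'
      · intro a ha b hb
        simp only [Finset.coe_range, Set.mem_Iio] at ha hb
        exact H.inj a b (by omega) (by omega)
    simpa using this
  have P : l = 0 ∨ Odd r := by
    by_contra hc
    push Not at hc
    obtain ⟨hc1, hc2⟩ := hc
    have := H.jac (l - 1) (l + 1 + r) (by omega) le_rfl (fun i h1 h2 => by
      have := B (l - 1) (by omega)
      rcases eq_or_ne i l with e | e
      · subst e; omega
      · have := C i (by omega) h2; omega) (by omega)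
    rw [Nat.odd_iff] at *
    omega
  refine ⟨P, fun i => if i < l then h i else 0, fun i => if i < r then h (l + 1 + i) - l else 0,
    ⟨?_, ?_, ?_, ?_, ?_⟩, ⟨?_, ?_, ?_, ?_, ?_⟩, ?_⟩
  · intro i hi; simpa [hi] using B i hi
  · intro i hi; simp; omega
  · intro i j hi hj; simp only [hi, hj, if_true]; exact H.inj i j (by omega) (by omega)
  · intro k e hke he hi hend
    have hk : k < l := by omega
    simp only [hk, if_true] at hi hend
    rcases eq_or_lt_of_le he with rfl | hel
    · have := H.jac k (e + 1 + r) (by omega) le_rfl (fun i h1 h2 => by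
        have := B k hk
        rcases lt_trichotomy i e with h' | h' | h'
        · simpa [h'] using hi i h1 h'
        · subst h'; omega
        · have := C i (by omega) h2; omega) (by omega)
      rcases P with P | P
      · omega
      · rw [Nat.odd_iff] at *; omega
    · refine H.jac k e hke (by omega) (fun i h1 h2 => ?_) (fun _ => ?_)
      · have := hi i h1 h2
        rwa [if_pos (by omega)] at this
      · have := hend hel
        rwa [if_pos (by omega)] at this
  · intro i j k hij hjk hk
    rw [if_pos (by omega), if_pos (by omega), if_pos (by omega)]
    exact H.av i j k hij hjk (by omega)
  · intro i hi
    rw [if_pos hi]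
    have := mx (l + 1 + i) (by omega) (by omega)
    omega
  · intro i hi; simp; omega
  · intro i j hi hj e
    rw [if_pos hi, if_pos hj] at e
    have h1 := C (l + 1 + i) (by omega) (by omega)
    have h2 := C (l + 1 + j) (by omega) (by omega)
    have := H.inj (l + 1 + i) (l + 1 + j) (by omega) (by omega) (by omega)
    omega
  · intro k e hke he hi hend
    have hk : k < r := by omega
    simp only [hk, if_true] at hi hend
    have c1 := C (l + 1 + k) (by omega) (by omega)
    have := H.jac (l + 1 + k) (l + 1 + e) (by omega) (by omega) (fun i h1 h2 => by
      obtain ⟨i', rfl⟩ : ∃ e', i = l + 1 + e' := ⟨i - l - 1, by omega⟩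
      have := hi i' (by omega) (by omega)
      rw [if_pos (by omega)] at this
      omega) (fun h => by
      have := hend (by omega)
      rw [if_pos (by omega)] at this
      have := C (l + 1 + e) (by omega) (by omega)
      omega)
    rwa [show l + 1 + e - (l + 1 + k) = e - k by omega] at this
  · intro i j k hij hjk hk
    rw [if_pos (by omega), if_pos (by omega), if_pos (by omega)]
    have := H.av (l + 1 + i) (l + 1 + j) (l + 1 + k) (by omega) (by omega) (by omega)
    have := C (l + 1 + i) (by omega) (by omega)
    have := C (l + 1 + j) (by omega) (by omega)
    have := C (l + 1 + k) (by omega) (by omega)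
    omega
  · funext i
    rcases lt_trichotomy i l with h' | h' | h'
    · rw [jglue1 h', if_pos h']
    · subst h'; rw [jglue2, hl]
    · obtain ⟨i', rfl⟩ : ∃ e', i = l + 1 + e' := ⟨i - l - 1, by omega⟩
      by_cases hr : i' < r
      · rw [jglue3 hr, if_pos hr]
        have := C (l + 1 + i') (by omega) (by omega)
        omega
      · rw [H.out _ (by omega)]
        have h1 : ¬ (l + 1 + i' < l) := by omega
        have h2 : ¬ (l + 1 + i' = l) := by omega
        simp [jglue, h1, h2, hr]

/-- Extension of a permutation by zero. -/
def jext {n : ℕ} (π : Equiv.Perm (Fin n)) : ℕ → ℕ := fun i => if h : i < n then π ⟨i, h⟩ else 0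

lemma jext_fin {n : ℕ} (π : Equiv.Perm (Fin n)) (i : Fin n) : jext π i = π i := by
  simp [jext]

lemma jext_lt {n : ℕ} (π : Equiv.Perm (Fin n)) {i : ℕ} (h : i < n) : jext π i = π ⟨i, h⟩ := by
  simp [jext, h]

lemma rho_eq {n : ℕ} (π : Equiv.Perm (Fin n)) (k : Fin n) (e : ℕ) (hke : (k : ℕ) < e) (he : e ≤ n)
    (h1 : ∀ i, (k : ℕ) < i → i < e → jext π k < jext π i) (h2 : e < n → jext π e < jext π k) :
    rhoLen π k = e - k - 1 := by
  have : e - k - 1 = Nat.card {j : ℕ // j ∈ Finset.Ioo (k : ℕ) e} := by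
    rw [Nat.card_eq_fintype_card, Fintype.card_coe, Nat.card_Ioo]
  rw [this, rhoLen]
  have Q : ∀ j : Fin n, (k < j ∧ ∀ i : Fin n, k < i → i ≤ j → π k < π i) ↔
      (j : ℕ) ∈ Finset.Ioo (k : ℕ) e := by
    intro j
    rw [Finset.mem_Ioo]
    constructor
    · rintro ⟨hj, H⟩
      refine ⟨hj, ?_⟩
      by_contra hc
      have hen : e < n := by have := j.2; omega
      have a := h2 hen
      have b := H ⟨e, hen⟩ hke (by rw [Fin.le_def]; simp; omega)
      rw [jext_fin, jext_lt π hen] at a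
      rw [Fin.lt_def] at b
      omega
    · rintro ⟨hj, hje⟩
      refine ⟨hj, fun i hi hij => ?_⟩
      have := h1 i hi (by rw [Fin.le_def] at hij; omega)
      rwa [jext_fin, jext_fin] at this
  refine Nat.card_congr ⟨fun j => ⟨j.1, (Q j.1).1 j.2⟩,
    fun j => ⟨⟨j.1, by have := Finset.mem_Ioo.1 j.2; omega⟩, (Q _).2 j.2⟩, fun j => rfl, fun j => rfl⟩

lemma jext_good {n : ℕ} (π : Equiv.Perm (Fin n)) :
    JGood n (jext π) ↔ IsJacobi π ∧ Avoids231 π := by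
  constructor
  · intro H
    constructor
    · intro k
      have hex : ∃ e, (k : ℕ) < e ∧ (e < n → jext π e < jext π k) := ⟨n, k.2, by simp⟩
      classical
      set e := Nat.find hex with hedef
      obtain ⟨he1, he2⟩ := Nat.find_spec hex
      have hen : e ≤ n := Nat.find_min' hex ⟨k.2, by simp⟩
      have hi : ∀ i, (k : ℕ) < i → i < e → jext π k < jext π i := by
        intro i h1 h2
        have h3 := Nat.find_min hex h2
        push Not at h3
        obtain ⟨h4, h5⟩ := h3 h1
        rcases eq_or_lt_of_le h5 with h6 | h6
        · have := H.inj _ _ k.2 h4 h6; omega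
        · exact h6
      rw [rho_eq π k e he1 hen hi he2]
      have := H.jac k e he1 hen hi he2
      rw [Nat.odd_iff] at this
      rw [Nat.even_iff]
      omega
    · rintro ⟨i, j, k, hij, hjk, h1, h2⟩
      refine H.av i j k hij hjk k.2 ⟨?_, ?_⟩
      · rw [jext_fin, jext_fin]; exact h1
      · rw [jext_fin, jext_fin]; exact h2
  · rintro ⟨hJ, hA⟩
    refine ⟨?_, ?_, ?_, ?_, ?_⟩
    · intro i hi; rw [jext_lt π hi]; exact (π _).2
    · intro i hi; simp [jext]; omega
    · intro i j hi hj h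
      rw [jext_lt π hi, jext_lt π hj] at h
      have := π.injective (Fin.ext h)
      simpa using this
    · intro k e hke he h1 h2
      have := hJ ⟨k, by omega⟩
      rw [rho_eq π ⟨k, by omega⟩ e hke he h1 h2] at this
      simp only [Nat.even_iff] at this
      rw [Nat.odd_iff]
      omega
    · rintro i j k hij hjk hk ⟨h1, h2⟩
      rw [jext_lt π hk, jext_lt π (by omega)] at h1
      rw [jext_lt π (by omega), jext_lt π (by omega)] at h2
      exact hA ⟨⟨i, by omega⟩, ⟨j, by omega⟩, ⟨k, hk⟩, hij, hjk, h1, h2⟩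

lemma jext_inj {n : ℕ} : Function.Injective (jext (n := n)) := by
  intro π σ h
  ext i
  rw [← jext_fin, ← jext_fin, h]

lemma jext_surj {n : ℕ} {f} (H : JGood n f) : ∃ π : Equiv.Perm (Fin n), jext π = f := by
  let g : Fin n → Fin n := fun i => ⟨f i, H.lt i i.2⟩
  have hg : Function.Injective g := by
    intro i j h
    have : f i = f j := by simpa [g] using h
    exact Fin.ext (H.inj i j i.2 j.2 this)
  refine ⟨Equiv.ofBijective g (Finite.injective_iff_bijective.1 hg), ?_⟩
  funext i
  by_cases hi : i < n
  · rw [jext_lt _ hi]; rfl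
  · rw [H.out i (by omega)]; simp [jext, hi]

/-- permutations and good functions -/
noncomputable def jequiv (n : ℕ) :
    {π : Equiv.Perm (Fin n) // IsJacobi π ∧ Avoids231 π} ≃ {f // JGood n f} :=
  Equiv.ofBijective (fun π => ⟨jext π.1, (jext_good π.1).2 π.2⟩) (by
    constructor
    · intro a b h
      exact Subtype.ext (jext_inj (congrArg Subtype.val h))
    · rintro ⟨f, hf⟩
      obtain ⟨π, rfl⟩ := jext_surj hf
      exact ⟨⟨π, (jext_good π).1 hf⟩, rfl⟩)

instance jfin (n : ℕ) : Finite {f // JGood n f} := Finite.of_equiv _ (jequiv n)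

/-- the count -/
noncomputable def jcount (n : ℕ) : ℕ := Nat.card {f // JGood n f}

lemma jglue_inj {l r f g f' g'} (hf : JGood l f) (hg : JGood r g) (hf' : JGood l f')
    (hg' : JGood r g') (h : jglue l r f g = jglue l r f' g') : f = f' ∧ g = g' := by
  constructor
  · funext i
    by_cases hi : i < l
    · have := congrFun h i
      rwa [jglue1 hi, jglue1 hi] at this
    · rw [hf.out i (by omega), hf'.out i (by omega)]
  · funext i
    by_cases hi : i < r
    · have := congrFun h (l + 1 + i)
      rw [jglue3 hi, jglue3 hi] at this
      omega
    · rw [hg.out i (by omega), hg'.out i (by omega)]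

lemma jcount_fiber (l r : ℕ) : Nat.card {f // JGood (l + 1 + r) f ∧ f l = l + r}
    = if l = 0 ∨ Odd r then jcount l * jcount r else 0 := by
  split_ifs with hlr
  · rw [jcount, jcount, ← Nat.card_prod]
    symm
    apply Nat.card_congr
    refine Equiv.ofBijective (fun x => ⟨jglue l r x.1.1 x.2.1,
      jglue_good x.1.2 x.2.2 hlr, jglue2⟩) ⟨?_, ?_⟩
    · rintro ⟨⟨f, hf⟩, ⟨g, hg⟩⟩ ⟨⟨f', hf'⟩, ⟨g', hg'⟩⟩ h
      obtain ⟨rfl, rfl⟩ := jglue_inj hf hg hf' hg' (congrArg Subtype.val h)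
      rfl
    · rintro ⟨h, H, hl⟩
      obtain ⟨_, f, g, hf, hg, rfl⟩ := jsplit H hl
      exact ⟨⟨⟨f, hf⟩, ⟨g, hg⟩⟩, rfl⟩
  · have : IsEmpty {f // JGood (l + 1 + r) f ∧ f l = l + r} :=
      ⟨fun x => hlr (jsplit x.2.1 x.2.2).1⟩
    exact Nat.card_of_isEmpty

lemma jcount_succ (m : ℕ) : jcount (m + 1) = ∑ p ∈ Finset.range (m + 1),
      if p = 0 ∨ Odd (m - p) then jcount p * jcount (m - p) else 0 := by
  have hF : ∀ p : Fin (m + 1), Finite {f // JGood (m + 1) f ∧ f p = m} := fun p =>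
    Finite.of_injective (fun x => (⟨x.1, x.2.1⟩ : {f // JGood (m + 1) f}))
      (fun a b h => Subtype.ext (by simpa using h))
  have e : jcount (m + 1) = Nat.card (Σ p : Fin (m + 1), {f // JGood (m + 1) f ∧ f p = m}) := by
    symm
    apply Nat.card_congr
    refine Equiv.ofBijective (fun x => ⟨x.2.1, x.2.2.1⟩) ⟨?_, ?_⟩
    · rintro ⟨p, f, hf, hp⟩ ⟨q, g, hg, hq⟩ h
      have h' : f = g := congrArg Subtype.val h
      subst h'
      have : p = q := Fin.ext (hf.inj p q p.2 q.2 (by rw [hp, hq]))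
      subst this
      rfl
    · rintro ⟨f, hf⟩
      obtain ⟨p, hp, h⟩ := jgood_max hf
      exact ⟨⟨⟨p, by omega⟩, f, hf, h⟩, rfl⟩
  rw [e, Nat.card_sigma, ← Fin.sum_univ_eq_sum_range (fun p =>
    if p = 0 ∨ Odd (m - p) then jcount p * jcount (m - p) else 0)]
  apply Finset.sum_congr rfl
  rintro ⟨p, hp⟩ _
  have := jcount_fiber p (m - p)
  rw [show p + 1 + (m - p) = m + 1 by omega, show p + (m - p) = m by omega] at this
  exact this

lemma jcount_zero : jcount 0 = 1 := by
  rw [jcount, ← Nat.card_congr (jequiv 0), Nat.card_eq_one_iff_unique]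
  refine ⟨inferInstance, ⟨⟨1, fun k => k.elim0, ?_⟩⟩⟩
  rintro ⟨i, _⟩
  exact i.elim0

/-- Enumeration of 231-avoiding Jacobi permutations of `[2n]` and `[2n+1]`. -/
theorem jacobi_avoid_231_count (n : ℕ) :
    (Nat.card {π : Equiv.Perm (Fin (2 * n)) // IsJacobi π ∧ Avoids231 π} : ℚ)
        = (1 / (2 * (n : ℚ) + 1)) * ((3 * n).choose n : ℕ) ∧
    (Nat.card {π : Equiv.Perm (Fin (2 * n + 1)) // IsJacobi π ∧ Avoids231 π} : ℚ)
        = (1 / (2 * (n : ℚ) + 1)) * ((3 * n + 1).choose (n + 1) : ℕ) := by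
  obtain ⟨h1, h2⟩ := jac_rec jcount jcount_zero jcount_succ n
  rw [Nat.card_congr (jequiv (2 * n)), Nat.card_congr (jequiv (2 * n + 1))]
  change ((jcount (2 * n) : ℕ) : ℚ) = _ ∧ ((jcount (2 * n + 1) : ℕ) : ℚ) = _
  rw [h1, h2]
  have hpos : (2 * (n : ℚ) + 1) ≠ 0 := by positivity
  have m1 := fcA_mul n 1
  have m2 := fcA_mul n 2
  constructor
  · rw [one_div, eq_inv_mul_iff_mul_eq₀ hpos]
    have c := Nat.add_one_mul_choose_eq (3 * n) n
    have c := Nat.choose_mul_succ_eq (3 * n) n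
    rw [show 3 * n + 1 - n = 2 * n + 1 by omega] at c
    rw [show 1 + 3 * n = 3 * n + 1 by ring] at m1
    have : (3 * n + 1) * ((2 * n + 1) * fcA n 1) = (3 * n + 1) * (3 * n).choose n := by
      zify at *
      linear_combination (2 * n + 1 : ℤ) * m1 - c
    have := Nat.eq_of_mul_eq_mul_left (by omega) this
    exact_mod_cast this
  · rw [one_div, eq_inv_mul_iff_mul_eq₀ hpos]
    have c := Nat.add_one_mul_choose_eq (3 * n + 1) n
    have c2 := Nat.choose_mul_succ_eq (3 * n + 1) (n + 1)
    have c3 := Nat.choose_succ_right_eq (3 * n + 2) n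
    rw [show 3 * n + 1 + 1 - (n + 1) = 2 * n + 1 by omega] at c2
    rw [show 3 * n + 2 - n = 2 * n + 2 by omega] at c3
    rw [show 2 + 3 * n = 3 * n + 2 by ring] at m2
    rw [show 3 * n + 1 + 1 = 3 * n + 2 by ring] at c2
    have : ((3 * n + 2) * (n + 1)) * ((2 * n + 1) * fcA n 2)
        = ((3 * n + 2) * (n + 1)) * (3 * n + 1).choose (n + 1) := by
      zify at *
      linear_combination ((n + 1) * (2 * n + 1) : ℤ) * m2 - (n + 1 : ℤ) * c2 - (2 * n + 1 : ℤ) * c3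
    have := Nat.eq_of_mul_eq_mul_left (by positivity) this
    exact_mod_cast this
end

section
/- For all n ≥ k ≥ 1 with n and k of the same parity, the number of Jacobi permutations of [n] avoiding 213 with exactly k left-to-right minima equals (2k/(3n−k))·C((3n−k)/2, n), and this also equals the number of Jacobi permutations of [n] avoiding 312 with exactly k left-to-right minima; if n and k have opposite parity, both counts are 0. -/
/-- The number of left-to-right minima of `π`. -/
noncomputable def lrminCount {n : ℕ} (π : Equiv.Perm (Fin n)) : ℕ :=
  Nat.card {k : Fin n // ∀ i : Fin n, i < k → π k < π i}

/-- Fuss–Catalan type numbers, defined by a Pascal-like recursion. -/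
def fussC : ℕ → ℕ → ℕ
  | 0, _ => 1
  | _ + 1, 0 => 0
  | m + 1, k + 1 => fussC (m + 1) k + fussC m (k + 3)
termination_by m k => (m, k)

theorem fussC_zero (k : ℕ) : fussC 0 k = 1 := by simp [fussC]
theorem fussC_succ_zero (m : ℕ) : fussC (m + 1) 0 = 0 := by simp [fussC]
theorem fussC_succ_succ (m k : ℕ) :
    fussC (m + 1) (k + 1) = fussC (m + 1) k + fussC m (k + 3) := by rw [fussC]

theorem fussC_closed (m : ℕ) : ∀ k, (3 * m + k) * fussC m k = k * (3 * m + k).choose m := by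
  induction m with
  | zero => intro k; simp [fussC_zero]
  | succ m ihm =>
    intro k
    induction k with
    | zero => simp [fussC_succ_zero]
    | succ k ihk =>
      have h3 := ihm (k + 3)
      have e1 : 3 * m + (k + 3) = 3 * (m + 1) + k := by ring
      have e2 : 3 * (m + 1) + (k + 1) = (3 * (m + 1) + k) + 1 := by ring
      rw [e1] at h3
      rw [e2, fussC_succ_succ]
      obtain ⟨N, hN⟩ : ∃ N, 3 * (m + 1) + k = N := ⟨_, rfl⟩
      rw [hN] at ihk h3 ⊢
      have a1 := Nat.add_one_mul_choose_eq N m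
      have a2 := Nat.choose_succ_right_eq N m
      have hm : m ≤ N := by omega
      obtain ⟨d, hd⟩ := Nat.exists_eq_add_of_le hm
      have hd' : N - m = d := by omega
      rw [hd'] at a2
      have hpos : 0 < N * (m + 1) := Nat.mul_pos (by omega) (by omega)
      apply Nat.eq_of_mul_eq_mul_left hpos
      zify at *
      have hk : (k : ℤ) = N - 3 * (m + 1) := by linarith
      have hd2 : (d : ℤ) = N - m := by linarith
      rw [hd2] at a2
      generalize ((N.choose m : ℕ) : ℤ) = C at *
      generalize ((N.choose (m+1) : ℕ) : ℤ) = C1 at *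
      generalize (((N+1).choose (m+1) : ℕ) : ℤ) = C2 at *
      generalize ((fussC (m+1) k : ℕ) : ℤ) = x at *
      generalize ((fussC m (k+3) : ℕ) : ℤ) = y at *
      generalize (k : ℤ) = k' at *
      subst hk
      linear_combination (m+1:ℤ) * (N + 1 : ℤ) * ihk + (m+1:ℤ) * (N + 1 : ℤ) * h3 + (N - 3 * (m+1) : ℤ) * (N+1) * a2 + (N - 3 * (m+1) + 1 : ℤ) * N * a1

theorem fussC_conv (j m : ℕ) : ∀ k, fussC m (j + k) =
    ∑ p ∈ Finset.HasAntidiagonal.antidiagonal m, fussC p.1 j * fussC p.2 k := by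
  induction m with
  | zero => intro k; simp [fussC_zero]
  | succ m ihm =>
    intro k
    induction k with
    | zero =>
      rw [Finset.Nat.antidiagonal_succ']
      simp [fussC_zero, fussC_succ_zero]
    | succ k ihk =>
      rw [← add_assoc, fussC_succ_succ, ihk, add_assoc, ihm,
        Finset.Nat.antidiagonal_succ', Finset.sum_cons, Finset.sum_cons,
        Finset.sum_map, Finset.sum_map, add_assoc, ← Finset.sum_add_distrib]
      simp [fussC_zero, fussC_succ_succ, mul_add]

theorem fussC_diag (m : ℕ) : ∀ r, ∑ i ∈ Finset.range (m + 1), fussC (m - i) (2 * i + r)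
    = fussC m (r + 1) := by
  induction m with
  | zero => intro r; simp [fussC_zero]
  | succ m ih =>
    intro r
    rw [Finset.sum_range_succ', fussC_succ_succ, ← ih (r + 2), add_comm]
    congr 1
    · simp
    · apply Finset.sum_congr rfl
      intro i hi
      congr 1
      · omega
      · ring

/-- The claimed counting function. -/
def gcount (n k : ℕ) : ℕ := if k ≤ n ∧ n % 2 = k % 2 then fussC ((n - k) / 2) k else 0

theorem sum_even (h : ℕ → ℕ) (hh : ∀ i, h (2 * i + 1) = 0) (q : ℕ) :
    ∑ j ∈ Finset.range (2 * q + 1), h j = ∑ i ∈ Finset.range (q + 1), h (2 * i) := by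
  induction q with
  | zero => simp
  | succ q ih =>
    rw [show 2 * (q + 1) + 1 = 2 * q + 1 + 1 + 1 by ring, Finset.sum_range_succ,
      Finset.sum_range_succ, ih, Finset.sum_range_succ _ (q + 1), hh]
    simp [mul_add]

theorem gcount_total (q : ℕ) : ∑ j ∈ Finset.range (2 * q + 1), gcount (2 * q) j = fussC q 1 := by
  rw [sum_even, ← fussC_diag q 0]
  · apply Finset.sum_congr rfl
    intro i hi
    rw [Finset.mem_range] at hi
    rw [gcount, if_pos (by omega)]
    congr 1
    omega
  · intro i
    rw [gcount, if_neg (by omega)]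

/-- Embedding of pairs used to reindex the convolution. -/
def evEmb (k : ℕ) : ℕ × ℕ ↪ ℕ × ℕ :=
  ⟨fun p => (2 * p.1 + k, 2 * p.2), by
    intro a b h
    simp at h
    ext <;> omega⟩

theorem evEmb_apply (k : ℕ) (p : ℕ × ℕ) : evEmb k p = (2 * p.1 + k, 2 * p.2) := rfl

theorem gcount_rec (n k : ℕ) : gcount (n + 1) (k + 1) =
    ∑ p ∈ Finset.HasAntidiagonal.antidiagonal n, if Even p.2 then
      gcount p.1 k * ∑ j ∈ Finset.range (p.2 + 1), gcount p.2 j else 0 := by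
  by_cases hp : k ≤ n ∧ n % 2 = k % 2
  · obtain ⟨m, hm⟩ : ∃ m, n = 2 * m + k := ⟨(n - k) / 2, by omega⟩
    subst hm
    rw [gcount, if_pos (by omega), show (2 * m + k + 1 - (k + 1)) / 2 = m by omega, fussC_conv]
    rw [← Finset.sum_filter]
    refine Eq.trans ?_ (Finset.sum_subset (s₁ := (Finset.HasAntidiagonal.antidiagonal m).map (evEmb k)) ?_ ?_)
    · rw [Finset.sum_map]
      apply Finset.sum_congr rfl
      intro p hp
      simp only [evEmb_apply]
      rw [gcount_total, gcount, if_pos (by omega)]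
      congr 2
      omega
    · intro p
      simp only [Finset.mem_map, Finset.HasAntidiagonal.mem_antidiagonal, Finset.mem_filter,
        evEmb_apply]
      rintro ⟨q, hq, rfl⟩
      exact ⟨by simp only; omega, by simp⟩
    · rintro ⟨a, b⟩ h1 h2
      simp only [Finset.mem_map, Finset.HasAntidiagonal.mem_antidiagonal, Finset.mem_filter,
        evEmb_apply, Nat.even_iff, Prod.mk.injEq, not_exists, not_and] at h1 h2
      rw [gcount, if_neg, zero_mul]
      intro hc
      exact h2 ((a - k) / 2, b / 2) (by simp only; omega) (by simp only; omega) (by simp only; omega)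
  · rw [gcount, if_neg (by omega)]
    symm
    apply Finset.sum_eq_zero
    rintro ⟨a, b⟩ h
    rw [Finset.HasAntidiagonal.mem_antidiagonal] at h
    simp only at h ⊢
    split_ifs with he
    · rw [Nat.even_iff] at he
      rw [gcount, if_neg (by omega), zero_mul]
    · rfl

theorem gcount_formula (n k : ℕ) (hk : 1 ≤ k) (hkn : k ≤ n) (h : n % 2 = k % 2) :
    (gcount n k : ℚ) = (2 * (k : ℚ) / ((3 * n - k : ℕ) : ℚ)) * (((3 * n - k) / 2).choose n : ℕ) := by
  obtain ⟨m, rfl⟩ : ∃ m, n = 2 * m + k := ⟨(n - k) / 2, by omega⟩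
  rw [gcount, if_pos ⟨hkn, h⟩, show (2 * m + k - k) / 2 = m by omega,
    show 3 * (2 * m + k) - k = 2 * (3 * m + k) by omega,
    show 2 * (3 * m + k) / 2 = 3 * m + k by omega]
  have h1 := fussC_closed m k
  have h2 : (3 * m + k).choose (2 * m + k) = (3 * m + k).choose m :=
    Nat.choose_symm_of_eq_add (by omega)
  rw [h2]
  have h3 : ((3 * m + k : ℕ) : ℚ) ≠ 0 := by
    have : 3 * m + k ≠ 0 := by omega
    exact_mod_cast this
  have h4 : ((3 * m + k : ℕ) : ℚ) * fussC m k = k * ((3 * m + k).choose m : ℕ) := by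
    exact_mod_cast h1
  rw [Nat.cast_mul]
  generalize ((3 * m + k : ℕ) : ℚ) = N at *
  field_simp
  push_cast
  linarith

/-- Jacobi property for words. -/
def Jac : List ℕ → Prop
  | [] => True
  | a :: l => Even (l.takeWhile (fun x => decide (a < x))).length ∧ Jac l

/-- Number of left-to-right minima of the reversed word. -/
def lrR : List ℕ → ℕ
  | [] => 0
  | x :: r => lrR r + if ∀ y ∈ r, x < y then 1 else 0

theorem takeWhile_cut (a s : ℕ) (hs : s < a) (A B : List ℕ) :
    (A ++ s :: B).takeWhile (fun x => decide (a < x)) = A.takeWhile (fun x => decide (a < x)) := by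
  induction A with
  | nil => simp [hs.le]
  | cons x A ih => simp [List.takeWhile_cons, ih]

theorem Jac_split (s : ℕ) (A B : List ℕ) (hA : ∀ a ∈ A, s < a) (hB : ∀ b ∈ B, s < b) :
    Jac (A ++ s :: B) ↔ Jac A ∧ Even B.length ∧ Jac B := by
  induction A with
  | nil =>
    have : B.takeWhile (fun x => decide (s < x)) = B := by
      rw [List.takeWhile_eq_self_iff]; simpa using hB
    simp [Jac, this]
  | cons a A ih =>
    have h1 := ih (fun x hx => hA x (by simp [hx]))
    rw [List.cons_append, Jac, Jac, h1, takeWhile_cut a s (hA a (by simp))]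
    tauto

theorem lrR_append (s : ℕ) (C D : List ℕ) (hC : ∀ a ∈ C, s < a) (hD : ∀ b ∈ D, s < b) :
    lrR (C ++ s :: D) = lrR D + 1 := by
  induction C with
  | nil => simp [lrR]; exact hD
  | cons c C ih =>
    rw [List.cons_append, lrR, ih (fun x hx => hC x (by simp [hx])), if_neg]
    intro h
    have h1 := h s (by simp)
    have h2 := hC c (by simp)
    omega

theorem lrR_split (s : ℕ) (A B : List ℕ) (hA : ∀ a ∈ A, s < a) (hB : ∀ b ∈ B, s < b) :
    lrR (A ++ s :: B).reverse = lrR A.reverse + 1 := by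
  rw [List.reverse_append, List.reverse_cons, List.append_assoc, List.singleton_append]
  apply lrR_append
  · simpa using hB
  · simpa using hA

theorem lrR_le (l : List ℕ) : lrR l ≤ l.length := by
  induction l with
  | nil => simp [lrR]
  | cons a l ih => rw [lrR, List.length_cons]; split_ifs <;> omega

open Classical in
/-- Jacobi words on the letters `s, …, s+n-1` with property `P` and `k` left-to-right minima. -/
noncomputable def Wset (P : List ℕ → Prop) (s n k : ℕ) : Finset (List ℕ) :=
  (List.range' s n).permutations.toFinset.filter
    (fun l => Jac l ∧ P l ∧ lrR l.reverse = k)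

theorem mem_Wset {P : List ℕ → Prop} {s n k : ℕ} {l : List ℕ} :
    l ∈ Wset P s n k ↔ l.Perm (List.range' s n) ∧ Jac l ∧ P l ∧ lrR l.reverse = k := by
  simp [Wset]

/-- `P` behaves well with respect to cutting at the minimum. -/
structure GoodPat (P : List ℕ → Prop) (oA oB : ℕ → ℕ → ℕ → ℕ) : Prop where
  nil : P []
  split : ∀ s A B, ((A ++ s :: B).Perm (List.range' s (A.length + B.length + 1)) ∧ P (A ++ s :: B)) ↔
    (A.Perm (List.range' (oA s A.length B.length) A.length) ∧
     B.Perm (List.range' (oB s A.length B.length) B.length) ∧ P A ∧ P B)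

theorem perm_bounds {s n : ℕ} {A B : List ℕ} (h : (A ++ s :: B).Perm (List.range' s (n + 1))) :
    (∀ a ∈ A, s < a) ∧ (∀ b ∈ B, s < b) ∧ A.length + B.length = n := by
  have h1 : (s :: (A ++ B)).Perm (s :: List.range' (s + 1) n) := by
    rw [← List.range'_succ]
    exact List.perm_middle.symm.trans h
  have h2 := (List.perm_cons s).1 h1
  have h3 : ∀ x ∈ A ++ B, s < x := by
    intro x hx
    have := h2.mem_iff.1 hx
    rw [List.mem_range'_1] at this
    omega
  refine ⟨fun a ha => h3 a (by simp [ha]), fun a ha => h3 a (by simp [ha]), ?_⟩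
  have := h2.length_eq
  simpa using this

theorem cut_inj {s : ℕ} {A B A' B' : List ℕ} (hA : ∀ a ∈ A, s < a) (hA' : ∀ a ∈ A', s < a)
    (h : A ++ s :: B = A' ++ s :: B') : A = A' ∧ B = B' := by
  induction A generalizing A' with
  | nil =>
    cases A' with
    | nil => simpa using h
    | cons x A' =>
      have := hA' x (by simp)
      simp at h
      omega
  | cons y A ih =>
    cases A' with
    | nil =>
      have := hA y (by simp)
      simp at h
      omega
    | cons x A' =>
      simp at h
      have := ih (fun x hx => hA x (by simp [hx])) (fun x hx => hA' x (by simp [hx])) h.2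
      exact ⟨by rw [h.1, this.1], this.2⟩

theorem card_Wset {P : List ℕ → Prop} {oA oB : ℕ → ℕ → ℕ → ℕ} (hP : GoodPat P oA oB) (n : ℕ) :
    ∀ s k, (Wset P s n k).card = gcount n k := by
  classical
  induction n using Nat.strong_induction_on with
  | _ n ih =>
  intro s k
  rcases n with _ | n
  · rcases k with _ | k
    · have : Wset P s 0 0 = {[]} := by
        ext l
        rw [mem_Wset]
        simp only [List.range'_zero, List.perm_nil, Finset.mem_singleton]
        constructor
        · exact fun h => h.1
        · rintro rfl
          exact ⟨rfl, trivial, hP.nil, rfl⟩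
      rw [this]
      simp [gcount, fussC_zero]
    · have : Wset P s 0 (k + 1) = ∅ := by
        rw [Finset.eq_empty_iff_forall_notMem]
        intro l
        rw [mem_Wset]
        simp only [List.range'_zero, List.perm_nil]
        rintro ⟨rfl, -, -, h⟩
        simp [lrR] at h
      rw [this]
      simp [gcount]
  -- every word contains its minimum
  have key : ∀ l : List ℕ, l.Perm (List.range' s (n + 1)) → ∃ A B, l = A ++ s :: B := by
    intro l hl
    have : s ∈ l := hl.mem_iff.2 (by simp)
    exact List.append_of_mem this
  rcases k with _ | k
  · have : Wset P s (n + 1) 0 = ∅ := by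
      rw [Finset.eq_empty_iff_forall_notMem]
      intro l
      rw [mem_Wset]
      rintro ⟨h1, -, -, h⟩
      obtain ⟨A, B, rfl⟩ := key l h1
      obtain ⟨hA, hB, -⟩ := perm_bounds h1
      rw [lrR_split s A B hA hB] at h
      omega
    rw [this, gcount]
    split_ifs with h
    · obtain ⟨m, hm⟩ : ∃ m, (n + 1 - 0) / 2 = m + 1 := ⟨(n + 1) / 2 - 1, by omega⟩
      rw [hm, fussC_succ_zero]; rfl
    · rfl
  rw [gcount_rec, ← Finset.sum_filter]
  have hT : ∀ b < n + 1, ∀ s, ((Finset.range (b + 1)).biUnion (Wset P s b)).card =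
      ∑ j ∈ Finset.range (b + 1), gcount b j := by
    intro b hb s
    rw [Finset.card_biUnion]
    · exact Finset.sum_congr rfl fun j _ => ih b hb s j
    · intro i _ j _ hij
      change Disjoint _ _
      rw [Finset.disjoint_left]
      intro l h1 h2
      rw [mem_Wset] at h1 h2
      exact hij (h1.2.2.2.symm.trans h2.2.2.2)
  have hmemT : ∀ b s l, l ∈ (Finset.range (b + 1)).biUnion (Wset P s b) ↔
      l.Perm (List.range' s b) ∧ Jac l ∧ P l := by
    intro b s l
    simp only [Finset.mem_biUnion, Finset.mem_range, mem_Wset]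
    constructor
    · rintro ⟨j, _, h1, h2, h3, _⟩
      exact ⟨h1, h2, h3⟩
    · rintro ⟨h1, h2, h3⟩
      refine ⟨lrR l.reverse, ?_, h1, h2, h3, rfl⟩
      have e1 := lrR_le l.reverse
      have e2 := h1.length_eq
      simp at e1 e2
      omega
  set S := (Finset.HasAntidiagonal.antidiagonal n).filter (fun p => Even p.2) with hS
  have hsum : ∑ p ∈ S, gcount p.1 k * ∑ j ∈ Finset.range (p.2 + 1), gcount p.2 j =
      (S.sigma (fun p => (Wset P (oA s p.1 p.2) p.1 k) ×ˢ
        ((Finset.range (p.2 + 1)).biUnion (Wset P (oB s p.1 p.2) p.2)))).card := by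
    rw [Finset.card_sigma]
    apply Finset.sum_congr rfl
    intro p hp
    rw [hS, Finset.mem_filter, Finset.HasAntidiagonal.mem_antidiagonal] at hp
    rw [Finset.card_product, hT _ (by omega), ih _ (by omega)]
  rw [hsum]
  symm
  have hmem : ∀ x : (_ : ℕ × ℕ) × (List ℕ × List ℕ), x ∈ (S.sigma (fun p => (Wset P (oA s p.1 p.2) p.1 k) ×ˢ
        ((Finset.range (p.2 + 1)).biUnion (Wset P (oB s p.1 p.2) p.2)))) →
      x.1 = (x.2.1.length, x.2.2.length) ∧ x.2.1 ++ s :: x.2.2 ∈ Wset P s (n + 1) (k + 1) := by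
    rintro ⟨⟨a, b⟩, A, B⟩ hx
    simp only [Finset.mem_sigma, Finset.mem_product, hmemT, mem_Wset, hS, Finset.mem_filter,
      Finset.HasAntidiagonal.mem_antidiagonal] at hx ⊢
    obtain ⟨⟨hn, he⟩, ⟨a1, a2, a3, a4⟩, b1, b2, b3⟩ := hx
    have la : A.length = a := by simpa using a1.length_eq
    have lb : B.length = b := by simpa using b1.length_eq
    subst la lb
    obtain ⟨c1, c2⟩ := (hP.split s A B).2 ⟨a1, b1, a3, b3⟩
    rw [hn] at c1
    obtain ⟨d1, d2, d3⟩ := perm_bounds c1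
    exact ⟨rfl, c1, (Jac_split s A B d1 d2).2 ⟨a2, he, b2⟩, c2, by rw [lrR_split s A B d1 d2, a4]⟩
  refine Finset.card_bij (fun x _ => x.2.1 ++ s :: x.2.2) (fun x hx => (hmem x hx).2) ?_ ?_
  · intro x hx y hy hxy
    obtain ⟨x1, x2⟩ := hmem x hx
    obtain ⟨y1, y2⟩ := hmem y hy
    rw [mem_Wset] at x2 y2
    obtain ⟨e1, e2⟩ := cut_inj (perm_bounds x2.1).1 (perm_bounds y2.1).1 hxy
    rcases x with ⟨p, A, B⟩
    rcases y with ⟨q, A', B'⟩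
    simp only at e1 e2 x1 y1
    subst e1 e2 x1 y1
    rfl
  · intro l hl
    rw [mem_Wset] at hl
    obtain ⟨h1, h2, h3, h4⟩ := hl
    obtain ⟨A, B, rfl⟩ := key l h1
    obtain ⟨d1, d2, d3⟩ := perm_bounds h1
    rw [← d3] at h1
    obtain ⟨c1, c2, c3, c4⟩ := (hP.split s A B).1 ⟨h1, h3⟩
    rw [Jac_split s A B d1 d2] at h2
    rw [lrR_split s A B d1 d2] at h4
    refine ⟨⟨(A.length, B.length), A, B⟩, ?_, rfl⟩
    simp only [Finset.mem_sigma, Finset.mem_product, hmemT, mem_Wset, hS, Finset.mem_filter,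
      Finset.HasAntidiagonal.mem_antidiagonal]
    exact ⟨⟨d3, h2.2.1⟩, ⟨c1, h2.1, c3, by omega⟩, c2, h2.2.2, c4⟩

theorem perm_range_split (X Y : List ℕ) (c : ℕ) :
    ((X ++ Y).Perm (List.range' c (X.length + Y.length)) ∧ ∀ x ∈ X, ∀ y ∈ Y, x < y) ↔
    (X.Perm (List.range' c X.length) ∧ Y.Perm (List.range' (c + X.length) Y.length)) := by
  constructor
  · rintro ⟨h1, h2⟩
    have hX := List.mergeSort_perm X (fun a b => decide (a ≤ b))
    have hY := List.mergeSort_perm Y (fun a b => decide (a ≤ b))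
    have h3 : X.mergeSort (fun a b => decide (a ≤ b)) ++ Y.mergeSort (fun a b => decide (a ≤ b))
        = List.range' c (X.length + Y.length) := by
      apply List.Perm.eq_of_pairwise' (r := (· ≤ ·))
      · rw [List.pairwise_append]
        refine ⟨List.pairwise_mergeSort' _ _, List.pairwise_mergeSort' _ _, ?_⟩
        intro a ha b hb
        exact (h2 a (hX.mem_iff.1 ha) b (hY.mem_iff.1 hb)).le
      · exact List.pairwise_le_range'
      · exact (hX.append hY).trans h1
    rw [← List.range'_append_1] at h3
    obtain ⟨e1, e2⟩ := List.append_inj h3 (by simp)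
    exact ⟨e1 ▸ hX.symm, e2 ▸ hY.symm⟩
  · rintro ⟨h1, h2⟩
    refine ⟨?_, ?_⟩
    · rw [← List.range'_append_1]
      exact h1.append h2
    · intro x hx y hy
      have a1 := h1.mem_iff.1 hx
      have a2 := h2.mem_iff.1 hy
      rw [List.mem_range'_1] at a1 a2
      omega

theorem cut_perm (s : ℕ) (A B : List ℕ) :
    (A ++ s :: B).Perm (List.range' s (A.length + B.length + 1)) ↔
      (A ++ B).Perm (List.range' (s + 1) (A.length + B.length)) := by
  rw [List.range'_succ, ← List.perm_cons s (l₁ := A ++ B)]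
  exact ⟨fun h => List.perm_middle.symm.trans h, fun h => List.perm_middle.trans h⟩

/-- 213-avoidance for words. -/
def LAv213 (l : List ℕ) : Prop := l.Triplewise (fun a b c => ¬ (b < a ∧ a < c))
/-- 312-avoidance for words. -/
def LAv312 (l : List ℕ) : Prop := l.Triplewise (fun a b c => ¬ (b < c ∧ c < a))

theorem LAv213_split (s : ℕ) (A B : List ℕ) (hA : ∀ a ∈ A, s < a) (hB : ∀ b ∈ B, s < b) 
    (hne : ∀ a ∈ A, ∀ b ∈ B, a ≠ b) :
    LAv213 (A ++ s :: B) ↔ LAv213 A ∧ LAv213 B ∧ ∀ b ∈ B, ∀ a ∈ A, b < a := by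
  unfold LAv213
  rw [List.triplewise_append, List.triplewise_cons]
  constructor
  · rintro ⟨h1, ⟨h2, h3⟩, h4, h5⟩
    refine ⟨h1, h3, fun b hb a ha => ?_⟩
    have := (List.pairwise_cons.1 (h4 a ha)).1 b hb
    have := hA a ha
    have := hne a ha b hb
    omega
  · rintro ⟨h1, h2, h3⟩
    refine ⟨h1, ⟨?_, h2⟩, ?_, ?_⟩
    · refine List.pairwise_of_forall_mem_list ?_
      intro x hx y hy
      have := hB x hx
      omega
    · intro a ha
      rw [List.pairwise_cons]
      refine ⟨fun b hb => ?_, ?_⟩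
      · have := h3 b hb a ha
        omega
      · refine List.pairwise_of_forall_mem_list ?_
        intro x hx y hy
        have := h3 y hy a ha
        omega
    · intro b hb
      refine List.pairwise_of_forall_mem_list ?_
      intro x hx y hy
      rcases List.mem_cons.1 hb with rfl | hb
      · have := hA x hx
        omega
      · have := h3 b hb x hx
        omega

theorem LAv312_split (s : ℕ) (A B : List ℕ) (hA : ∀ a ∈ A, s < a) (hB : ∀ b ∈ B, s < b) 
    (hne : ∀ a ∈ A, ∀ b ∈ B, a ≠ b) :
    LAv312 (A ++ s :: B) ↔ LAv312 A ∧ LAv312 B ∧ ∀ a ∈ A, ∀ b ∈ B, a < b := by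
  unfold LAv312
  rw [List.triplewise_append, List.triplewise_cons]
  constructor
  · rintro ⟨h1, ⟨h2, h3⟩, h4, h5⟩
    refine ⟨h1, h3, fun a ha b hb => ?_⟩
    have := (List.pairwise_cons.1 (h4 a ha)).1 b hb
    have := hB b hb
    have := hne a ha b hb
    omega
  · rintro ⟨h1, h2, h3⟩
    refine ⟨h1, ⟨?_, h2⟩, ?_, ?_⟩
    · refine List.pairwise_of_forall_mem_list ?_
      intro x hx y hy
      have := hB y hy
      omega
    · intro a ha
      rw [List.pairwise_cons]
      refine ⟨fun b hb => ?_, ?_⟩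
      · have := h3 a ha b hb
        omega
      · refine List.pairwise_of_forall_mem_list ?_
        intro x hx y hy
        have := h3 a ha y hy
        omega
    · intro b hb
      refine List.pairwise_of_forall_mem_list ?_
      intro x hx y hy
      rcases List.mem_cons.1 hb with rfl | hb
      · have := hA y hy
        omega
      · have := h3 x hx b hb
        omega

theorem perm_ne {c n : ℕ} {A B : List ℕ} (h : (A ++ B).Perm (List.range' c n)) :
    ∀ a ∈ A, ∀ b ∈ B, a ≠ b := by
  have h1 : (A ++ B).Nodup := h.nodup_iff.2 List.nodup_range'
  exact (List.nodup_append.1 h1).2.2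

theorem good312 : GoodPat LAv312 (fun s _ _ => s + 1) (fun s a _ => s + 1 + a) where
  nil := List.Triplewise.nil
  split s A B := by
    have h0 := perm_range_split A B (s + 1)
    have hlt : (A ++ B).Perm (List.range' (s + 1) (A.length + B.length)) →
      (LAv312 (A ++ s :: B) ↔ LAv312 A ∧ LAv312 B ∧ ∀ a ∈ A, ∀ b ∈ B, a < b) := fun h => by
        have hb := perm_bounds ((cut_perm s A B).2 h)
        exact LAv312_split s A B hb.1 hb.2.1 (perm_ne h)
    rw [cut_perm]
    tauto

theorem good213 : GoodPat LAv213 (fun s _ b => s + 1 + b) (fun s _ _ => s + 1) where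
  nil := List.Triplewise.nil
  split s A B := by
    have h0 := perm_range_split B A (s + 1)
    have h1 : (B ++ A).Perm (List.range' (s + 1) (B.length + A.length)) ↔
        (A ++ B).Perm (List.range' (s + 1) (A.length + B.length)) := by
      rw [add_comm B.length]
      exact ⟨fun h => List.perm_append_comm.trans h, fun h => List.perm_append_comm.trans h⟩
    have hlt : (A ++ B).Perm (List.range' (s + 1) (A.length + B.length)) →
      (LAv213 (A ++ s :: B) ↔ LAv213 A ∧ LAv213 B ∧ ∀ b ∈ B, ∀ a ∈ A, b < a) := fun h => by
        have hb := perm_bounds ((cut_perm s A B).2 h)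
        exact LAv213_split s A B hb.1 hb.2.1 (perm_ne h)
    rw [cut_perm]
    tauto

theorem takeWhile_ofFn (p : ℕ → Bool) (n : ℕ) : ∀ f : Fin n → ℕ,
    ((List.ofFn f).takeWhile p).length = Nat.card {j : Fin n // ∀ i ≤ j, p (f i) = true} := by
  classical
  induction n with
  | zero => intro f; simp
  | succ n ih =>
    intro f
    rw [Nat.card_eq_fintype_card, Fintype.card_subtype, Fin.card_filter_univ_succ, List.ofFn_succ,
      List.takeWhile_cons]
    have ih' := ih (fun i => f i.succ)
    rw [Nat.card_eq_fintype_card, Fintype.card_subtype] at ih'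
    by_cases h0 : p (f 0) = true
    · rw [if_pos h0, if_pos, List.length_cons, ih']
      · congr 3
        ext j
        simp [Fin.forall_fin_succ, h0]
      · intro i hi
        rw [Fin.le_zero_iff.1 hi]
        exact h0
    · rw [if_neg h0, if_neg]
      · symm
        rw [List.length_nil, Finset.card_eq_zero, Finset.filter_eq_empty_iff]
        intro j _ h
        exact h0 (h 0 (Fin.zero_le _))
      · intro h
        exact h0 (h 0 le_rfl)

/-- `rhoLen` for arbitrary functions. -/
noncomputable def rhoF {n : ℕ} (f : Fin n → ℕ) (k : Fin n) : ℕ :=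
  Nat.card {j : Fin n // k < j ∧ ∀ i : Fin n, k < i → i ≤ j → f k < f i}

theorem rhoF_zero {n : ℕ} (f : Fin (n + 1) → ℕ) : rhoF f 0 =
    ((List.ofFn fun i : Fin n => f i.succ).takeWhile (fun x => decide (f 0 < x))).length := by
  classical
  rw [takeWhile_ofFn, rhoF, Nat.card_eq_fintype_card, Nat.card_eq_fintype_card,
    Fintype.card_subtype, Fintype.card_subtype, Fin.card_filter_univ_succ, if_neg (by simp)]
  congr 2
  ext j
  simp [Fin.forall_fin_succ]

theorem rhoF_succ {n : ℕ} (f : Fin (n + 1) → ℕ) (k : Fin n) : rhoF f k.succ =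
    rhoF (fun i => f i.succ) k := by
  classical
  rw [rhoF, rhoF, Nat.card_eq_fintype_card, Nat.card_eq_fintype_card,
    Fintype.card_subtype, Fintype.card_subtype, Fin.card_filter_univ_succ, if_neg (by simp)]
  congr 2
  ext j
  simp [Fin.forall_fin_succ]

theorem Jac_ofFn (n : ℕ) : ∀ f : Fin n → ℕ, Jac (List.ofFn f) ↔ ∀ k, Even (rhoF f k) := by
  induction n with
  | zero => intro f; simp [Jac]
  | succ n ih =>
    intro f
    rw [List.ofFn_succ, Jac, Fin.forall_fin_succ, ih, rhoF_zero]
    simp only [rhoF_succ]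

theorem lrR_ofFn (n : ℕ) : ∀ f : Fin n → ℕ, lrR (List.ofFn f).reverse =
    Nat.card {k : Fin n // ∀ i : Fin n, i < k → f k < f i} := by
  classical
  induction n with
  | zero => intro f; simp [lrR]
  | succ n ih =>
    intro f
    have ih' := ih (fun i => f i.castSucc)
    rw [Nat.card_eq_fintype_card, Fintype.card_subtype, Finset.card_filter] at ih' ⊢
    rw [Fin.sum_univ_castSucc, List.ofFn_succ_last, List.reverse_append, List.reverse_singleton,
      List.singleton_append, lrR, ih']
    congr 1
    · apply Finset.sum_congr rfl
      intro k _
      congr 1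
      simp [Fin.forall_fin_succ', Fin.not_lt.2 (Fin.le_last _)]
    · congr 1
      simp [Fin.forall_fin_succ']

theorem triple_ofFn {n : ℕ} (f : Fin n → ℕ) (p : ℕ → ℕ → ℕ → Prop) :
    (List.ofFn f).Triplewise p ↔ ∀ i j k : Fin n, i < j → j < k → p (f i) (f j) (f k) := by
  rw [List.triplewise_iff_getElem]
  simp only [List.getElem_ofFn, List.length_ofFn]
  constructor
  · intro h i j k hij hjk
    exact h i j k hij hjk k.2
  · intro h i j k hij hjk hk
    exact h ⟨i, by omega⟩ ⟨j, by omega⟩ ⟨k, hk⟩ hij hjk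

theorem transfer (P : List ℕ → Prop) (n k : ℕ) (Q : Equiv.Perm (Fin n) → Prop)
    (hQ : ∀ π : Equiv.Perm (Fin n), Q π ↔ P (List.ofFn fun i => (π i : ℕ))) :
    Nat.card {π : Equiv.Perm (Fin n) // IsJacobi π ∧ Q π ∧ lrminCount π = k} =
      (Wset P 0 n k).card := by
  classical
  rw [Nat.card_eq_fintype_card, Fintype.card_subtype]
  have hstat : ∀ π : Equiv.Perm (Fin n), (IsJacobi π ∧ Q π ∧ lrminCount π = k) ↔
      (Jac (List.ofFn fun i => (π i : ℕ)) ∧ P (List.ofFn fun i => (π i : ℕ)) ∧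
        lrR (List.ofFn fun i => (π i : ℕ)).reverse = k) := by
    intro π
    rw [Jac_ofFn, lrR_ofFn, hQ]
    rfl
  refine Finset.card_bij (fun π _ => List.ofFn fun i => (π i : ℕ)) ?_ ?_ ?_
  · intro π hπ
    rw [Finset.mem_filter] at hπ
    rw [mem_Wset]
    refine ⟨?_, (hstat π).1 hπ.2⟩
    rw [List.perm_ext_iff_of_nodup _ List.nodup_range']
    · intro x
      rw [List.mem_ofFn', List.mem_range'_1]
      constructor
      · rintro ⟨i, rfl⟩
        have := (π i).2
        simp only
        omega
      · rintro ⟨_, hx⟩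
        exact ⟨π.symm ⟨x, by omega⟩, by simp⟩
    · rw [List.nodup_ofFn]
      exact Fin.val_injective.comp π.injective
  · intro π _ σ _ h
    have h1 := List.ofFn_injective h
    ext i
    exact congrFun h1 i
  · intro l hl
    rw [mem_Wset] at hl
    have hlen : l.length = n := by simpa using hl.1.length_eq
    have hnd : l.Nodup := hl.1.nodup_iff.2 List.nodup_range'
    have hlt : ∀ x ∈ l, x < n := by
      intro x hx
      have := hl.1.mem_iff.1 hx
      rw [List.mem_range'_1] at this
      omega
    subst hlen
    let g : Fin l.length → Fin l.length := fun i => ⟨l.get i, hlt _ (List.get_mem l i)⟩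
    have hg : Function.Injective g := by
      intro i j h
      have : l.get i = l.get j := congrArg Fin.val h
      exact hnd.injective_get this
    let π : Equiv.Perm (Fin l.length) := Equiv.ofBijective g (Finite.injective_iff_bijective.1 hg)
    have hπ : (List.ofFn fun i => (π i : ℕ)) = l := List.ofFn_get l
    refine ⟨π, ?_, hπ⟩
    rw [Finset.mem_filter]
    refine ⟨Finset.mem_univ _, ?_⟩
    rw [hstat, hπ]
    exact hl.2

theorem count213 (n k : ℕ) : Nat.card {π : Equiv.Perm (Fin n) //
    IsJacobi π ∧ Avoids213 π ∧ lrminCount π = k} = gcount n k := by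
  rw [transfer LAv213 n k Avoids213, card_Wset good213]
  intro π
  rw [LAv213, triple_ofFn, Avoids213]
  push Not
  rfl

theorem count312 (n k : ℕ) : Nat.card {π : Equiv.Perm (Fin n) //
    IsJacobi π ∧ Avoids312 π ∧ lrminCount π = k} = gcount n k := by
  rw [transfer LAv312 n k Avoids312, card_Wset good312]
  intro π
  rw [LAv312, triple_ofFn, Avoids312]
  push Not
  rfl

/-- Counting 213- and 312-avoiding Jacobi permutations by left-to-right minima. -/
theorem jacobi_avoid_213_312_lrmin (n k : ℕ) (hk : 1 ≤ k) (hkn : k ≤ n) :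
    (n % 2 = k % 2 →
      (Nat.card {π : Equiv.Perm (Fin n) //
          IsJacobi π ∧ Avoids213 π ∧ lrminCount π = k} : ℚ)
        = (2 * (k : ℚ) / ((3 * n - k : ℕ) : ℚ)) * (((3 * n - k) / 2).choose n : ℕ) ∧
      (Nat.card {π : Equiv.Perm (Fin n) //
          IsJacobi π ∧ Avoids312 π ∧ lrminCount π = k} : ℚ)
        = (2 * (k : ℚ) / ((3 * n - k : ℕ) : ℚ)) * (((3 * n - k) / 2).choose n : ℕ)) ∧
    (n % 2 ≠ k % 2 →
      Nat.card {π : Equiv.Perm (Fin n) //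
          IsJacobi π ∧ Avoids213 π ∧ lrminCount π = k} = 0 ∧
      Nat.card {π : Equiv.Perm (Fin n) //
          IsJacobi π ∧ Avoids312 π ∧ lrminCount π = k} = 0) := by
  refine ⟨fun h => ?_, fun h => ?_⟩
  · rw [count213, count312]
    exact ⟨gcount_formula n k hk hkn h, gcount_formula n k hk hkn h⟩
  · rw [count213, count312, gcount, if_neg (fun hc => h hc.2)]
    exact ⟨rfl, rfl⟩
end
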